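/- Let C be an algebra of global dimension 2 and B = C ⋉ Ext^2_C(DC,C). If M is a faithful τ_C-rigid C-module, then M is τ_B-rigid if and only if id_C M ≤ 1. -/

import Mathlib

open CategoryTheory MulOpposite

open CategoryTheory MulOpposite

/-! Core definitions: right `A`-modules are modules over `Aᵐᵒᵖ`. -/

/-- The category of (small) modules over a ring `R`.  For a `k`-algebra `A`,
right `A`-modules are `Mdl Aᵐᵒᵖ`. -/
abbrev Mdl (R : Type) [Ring R] := ModuleCat.{0} R

section Generic

variable (R : Type) [Ring R]

/-- `f : P → M` is a projective cover: `P` projective, `f` surjective with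
superfluous kernel. -/
def IsProjCover {P M : Mdl R} (f : P →ₗ[R] M) : Prop :=
  Module.Projective R P ∧ Function.Surjective f ∧
    ∀ N : Submodule R P, N ⊔ LinearMap.ker f = ⊤ → N = ⊤

/-- `f : M → I` is an injective envelope: `I` injective, `f` injective with
essential image. -/
def IsInjEnv {M I : Mdl R} (f : M →ₗ[R] I) : Prop :=
  Module.Injective R I ∧ Function.Injective f ∧
    ∀ K : Submodule R I, K ⊓ LinearMap.range f = ⊥ → K = ⊥

/-- `Hom_R(X, Y) = 0`. -/
def HomZero (X Y : Mdl R) : Prop := ∀ f : X →ₗ[R] Y, f = 0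

/-- `X ∈ Gen M`: `X` is an epimorphic image of a finite direct sum of copies of `M`. -/
def MemGen (M X : Mdl R) : Prop :=
  ∃ (d : ℕ) (f : (Fin d → M) →ₗ[R] X), Function.Surjective f

/-- `X ∈ add M`: `X` is a direct summand of a finite direct sum of copies of `M`. -/
def MemAdd (M X : Mdl R) : Prop :=
  ∃ (n : ℕ) (s : X →ₗ[R] (Fin n → M)) (r : (Fin n → M) →ₗ[R] X),
    r.comp s = LinearMap.id

/-- projective dimension at most 1: a length-one projective resolution exists. -/
def PdLE1 (M : Mdl R) : Prop :=
  ∃ (P1 P0 : Mdl R) (d1 : P1 →ₗ[R] P0) (d0 : P0 →ₗ[R] M),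
    Module.Projective R P1 ∧ Module.Projective R P0 ∧
    Function.Injective d1 ∧ Function.Surjective d0 ∧
    LinearMap.range d1 = LinearMap.ker d0

/-- projective dimension at most 2. -/
def PdLE2 (M : Mdl R) : Prop :=
  ∃ (P2 P1 P0 : Mdl R) (d2 : P2 →ₗ[R] P1) (d1 : P1 →ₗ[R] P0) (d0 : P0 →ₗ[R] M),
    Module.Projective R P2 ∧ Module.Projective R P1 ∧ Module.Projective R P0 ∧
    Function.Injective d2 ∧ Function.Surjective d0 ∧
    LinearMap.range d2 = LinearMap.ker d1 ∧ LinearMap.range d1 = LinearMap.ker d0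

/-- injective dimension at most 1. -/
def IdLE1 (M : Mdl R) : Prop :=
  ∃ (I0 I1 : Mdl R) (d0 : M →ₗ[R] I0) (d1 : I0 →ₗ[R] I1),
    Module.Injective R I0 ∧ Module.Injective R I1 ∧
    Function.Injective d0 ∧ Function.Surjective d1 ∧
    LinearMap.range d0 = LinearMap.ker d1

/-- global dimension at most 2 (every module has projective dimension ≤ 2). -/
def GlDimLE2 : Prop := ∀ M : Mdl R, PdLE2 R M

/-- global dimension exactly 2. -/
def GlDimEq2 : Prop := GlDimLE2 R ∧ ¬ ∀ M : Mdl R, PdLE1 R M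

/-- `W` is a first syzygy `Ω M` of `M` (kernel of a projective cover). -/
def IsSyzygy (M W : Mdl R) : Prop :=
  ∃ (P : Mdl R) (f : P →ₗ[R] M), IsProjCover R f ∧
    Nonempty (W ≃ₗ[R] LinearMap.ker f)

/-- `W` is a first cosyzygy `Ω⁻¹ M` of `M` (cokernel of an injective envelope). -/
def IsCosyzygy (M W : Mdl R) : Prop :=
  ∃ (I : Mdl R) (f : M →ₗ[R] I), IsInjEnv R f ∧
    Nonempty (W ≃ₗ[R] (I ⧸ LinearMap.range f))

/-- `P1 --d1--> P0 --d0--> M → 0` is a minimal projective presentation. -/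
def IsMinPres {P1 P0 M : Mdl R} (d1 : P1 →ₗ[R] P0) (d0 : P0 →ₗ[R] M) : Prop :=
  IsProjCover R d0 ∧ Module.Projective R P1 ∧
  LinearMap.range d1 = LinearMap.ker d0 ∧
  ∀ N : Submodule R P1, N ⊔ LinearMap.ker d1 = ⊤ → N = ⊤

/-- `Ext¹_R(X, Y) = 0`, expressed as: every short exact sequence
`0 → Y → Z → X → 0` splits. -/
def Ext1Zero (X Y : Mdl R) : Prop :=
  ∀ (Z : Mdl R) (i : Y →ₗ[R] Z) (p : Z →ₗ[R] X),
    Function.Injective i → Function.Surjective p →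
    LinearMap.range i = LinearMap.ker p →
    ∃ s : X →ₗ[R] Z, p.comp s = LinearMap.id

/-- partial tilting module: `pd ≤ 1` and `Ext¹(M,M) = 0`. -/
def PartialTilting (M : Mdl R) : Prop := PdLE1 R M ∧ Ext1Zero R M M

/-- tilting module: partial tilting plus a coresolution
`0 → R → T' → T'' → 0` with `T', T'' ∈ add M` of the regular module. -/
def IsTilting (M : Mdl R) : Prop :=
  PartialTilting R M ∧
  ∃ (T' T'' : Mdl R) (i : ModuleCat.of R R →ₗ[R] T') (p : T' →ₗ[R] T''),
    MemAdd R M T' ∧ MemAdd R M T'' ∧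
    Function.Injective i ∧ Function.Surjective p ∧
    LinearMap.range i = LinearMap.ker p

/-- an indecomposable (nonzero) module. -/
def Indecomp (M : Mdl R) : Prop :=
  Nontrivial M ∧ ∀ (U V : Submodule R M), IsCompl U V → U = ⊥ ∨ V = ⊥

/-- the number of isomorphism classes of simple `R`-modules is `n`. -/
def SimpleCount (n : ℕ) : Prop :=
  ∃ S : Fin n → Mdl R,
    (∀ i, IsSimpleModule R (S i)) ∧
    (∀ i j, Nonempty ((S i) ≃ₗ[R] (S j)) → i = j) ∧
    ∀ X : Mdl R, IsSimpleModule R X → ∃ i, Nonempty (X ≃ₗ[R] S i)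

end Generic

section Duality

variable (k : Type) [Field k] (A : Type) [Ring A] [Algebra k A]

/-- `N` (a right `A`-module) is the `k`-linear dual `D M` of the left `A`-module `M`:
witnessed by a nondegenerate balanced `k`-bilinear pairing. -/
def IskDual (N : Mdl Aᵐᵒᵖ) (M : Mdl A) : Prop :=
  ∃ φ : N → M → k,
    (∀ n n' m, φ (n + n') m = φ n m + φ n' m) ∧
    (∀ n m m', φ n (m + m') = φ n m + φ n m') ∧
    (∀ (c : k) n m, φ n ((algebraMap k A c) • m) = c * φ n m) ∧
    (∀ (a : A) n m, φ (op a • n) m = φ n (a • m)) ∧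
    (∀ n, (∀ m, φ n m = 0) → n = 0) ∧
    (∀ m, (∀ n, φ n m = 0) → m = 0)

/-- `T = τ M`: the Auslander–Reiten translate of the right `A`-module `M`,
i.e. the `k`-dual of the transpose `Tr M` computed from a minimal projective
presentation. -/
def IsTau (M T : Mdl Aᵐᵒᵖ) : Prop :=
  ∃ (P1 P0 : Mdl Aᵐᵒᵖ) (d1 : P1 →ₗ[Aᵐᵒᵖ] P0) (d0 : P0 →ₗ[Aᵐᵒᵖ] M),
    IsMinPres Aᵐᵒᵖ d1 d0 ∧
    ∃ (Tr : Mdl A) (q : (P1 →ₗ[Aᵐᵒᵖ] A) →ₗ[A] Tr),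
      Function.Surjective q ∧
      (∀ g : P1 →ₗ[Aᵐᵒᵖ] A, q g = 0 ↔ ∃ f : P0 →ₗ[Aᵐᵒᵖ] A, g = f.comp d1) ∧
      IskDual k A T Tr

/-- `T = τ⁻¹ M`: the inverse Auslander–Reiten translate, `Tr (D M)`, computed
from a minimal projective presentation of the left module `D M`. -/
def IsTauInv (M T : Mdl Aᵐᵒᵖ) : Prop :=
  ∃ (DM : Mdl A), IskDual k A M DM ∧
  ∃ (Q1 Q0 : Mdl A) (d1 : Q1 →ₗ[A] Q0) (d0 : Q0 →ₗ[A] DM),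
    IsMinPres A d1 d0 ∧
    ∃ q : (Q1 →ₗ[A] A) →ₗ[Aᵐᵒᵖ] T,
      Function.Surjective q ∧
      ∀ g : Q1 →ₗ[A] A, q g = 0 ↔ ∃ f : Q0 →ₗ[A] A, g = f.comp d1

/-- `W = τ⁻¹ Ω⁻¹ M`. -/
def IsTauInvCosyz (M W : Mdl Aᵐᵒᵖ) : Prop :=
  ∃ V, IsCosyzygy Aᵐᵒᵖ M V ∧ IsTauInv k A V W

/-- `W = τ Ω M`. -/
def IsTauSyz (M W : Mdl Aᵐᵒᵖ) : Prop :=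
  ∃ V, IsSyzygy Aᵐᵒᵖ M V ∧ IsTau k A V W

/-- `M` is `τ`-rigid: `Hom(M, τM) = 0`. -/
def TauRigid (M : Mdl Aᵐᵒᵖ) : Prop :=
  ∀ T, IsTau k A M T → HomZero Aᵐᵒᵖ M T

/-- `M` is `τ`-tilting: `τ`-rigid with as many pairwise nonisomorphic
indecomposable summands as there are simple modules. -/
def TauTilting (M : Mdl Aᵐᵒᵖ) : Prop :=
  TauRigid k A M ∧
  ∃ (n : ℕ) (N : Fin n → Mdl Aᵐᵒᵖ),
    (∀ i, Indecomp Aᵐᵒᵖ (N i)) ∧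
    (∀ i j, Nonempty ((N i) ≃ₗ[Aᵐᵒᵖ] (N j)) → i = j) ∧
    Nonempty (M ≃ₗ[Aᵐᵒᵖ] ((i : Fin n) → N i)) ∧
    SimpleCount Aᵐᵒᵖ n

end Duality


section SplitExt

variable {B C : Type} [Ring B] [Ring C]

/-- a right `C`-module viewed as a right `B`-module via a ring hom `π : B → C`. -/
def modAlong (π : B →+* C) (M : Mdl Cᵐᵒᵖ) : Mdl Bᵐᵒᵖ :=
  letI : Module Bᵐᵒᵖ M := Module.compHom M (RingHom.op π)
  ModuleCat.of _ M

/-- `X` is the induced module `M ⊗_C B` along `σ : C → B`, characterized by the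
universal property of induction (extension of scalars). -/
def IsInducedAlong (σ : C →+* B) (M : Mdl Cᵐᵒᵖ) (X : Mdl Bᵐᵒᵖ) : Prop :=
  ∃ φ : M →+ X,
    (∀ (c : C) (m : M), φ (op c • m) = op (σ c) • φ m) ∧
    ∀ (Y : Mdl Bᵐᵒᵖ) (ψ : M →+ Y),
      (∀ (c : C) (m : M), ψ (op c • m) = op (σ c) • ψ m) →
      ∃! h : X →ₗ[Bᵐᵒᵖ] Y, ∀ m, h (φ m) = ψ m

/-- `X` is the coinduced module `D(B ⊗_C D M) ≅ Hom_C(B, M)` along `σ : C → B`,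
characterized by the universal property of coinduction. -/
def IsCoinducedAlong (σ : C →+* B) (M : Mdl Cᵐᵒᵖ) (X : Mdl Bᵐᵒᵖ) : Prop :=
  ∃ p : X →+ M,
    (∀ (c : C) (x : X), p (op (σ c) • x) = op c • p x) ∧
    ∀ (Y : Mdl Bᵐᵒᵖ) (ψ : Y →+ M),
      (∀ (c : C) (y : Y), ψ (op (σ c) • y) = op c • ψ y) →
      ∃! h : Y →ₗ[Bᵐᵒᵖ] X, ∀ y, p (h y) = ψ y

end SplitExt

section TrivExt

variable (C : Type) [Ring C] (E : Type) [AddCommGroup E]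
  [Module C E] [Module Cᵐᵒᵖ E] [SMulCommClass C Cᵐᵒᵖ E]

/-- the projection `B = C ⋉ E → C` as a ring hom. -/
def tszeFst : TrivSqZeroExt C E →+* C where
  toFun := TrivSqZeroExt.fst
  map_one' := rfl
  map_mul' _ _ := rfl
  map_zero' := rfl
  map_add' _ _ := rfl

/-- the inclusion `σ : C → B = C ⋉ E` as a ring hom. -/
def tszeInl : C →+* TrivSqZeroExt C E where
  toFun := TrivSqZeroExt.inl
  map_one' := rfl
  map_mul' x y := TrivSqZeroExt.inl_mul (M := E) x y
  map_zero' := TrivSqZeroExt.inl_zero (M := E)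
  map_add' x y := TrivSqZeroExt.inl_add (M := E) x y

/-- a right `C`-module viewed as a module over the trivial extension `C ⋉ E`. -/
def modB (M : Mdl Cᵐᵒᵖ) : Mdl (TrivSqZeroExt C E)ᵐᵒᵖ :=
  modAlong (tszeFst C E) M

/-- `X = M ⊗_C B` for `B = C ⋉ E`. -/
def IsInduced (M : Mdl Cᵐᵒᵖ) (X : Mdl (TrivSqZeroExt C E)ᵐᵒᵖ) : Prop :=
  IsInducedAlong (tszeInl C E) M X

/-- `X = D(B ⊗_C D M)` for `B = C ⋉ E`. -/
def IsCoinduced (M : Mdl Cᵐᵒᵖ) (X : Mdl (TrivSqZeroExt C E)ᵐᵒᵖ) : Prop :=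
  IsCoinducedAlong (tszeInl C E) M X

end TrivExt

section RelExt

variable (k : Type) [Field k] (C : Type) [Ring C] [Algebra k C]
  (E : Type) [AddCommGroup E] [Module C E] [Module Cᵐᵒᵖ E]

/-- The `C`-`C`-bimodule `E` is `Ext²_C(DC, C)`: there is a projective
resolution `0 → P2 → P1 → P0 → DC → 0` of the right module `DC = Hom_k(C,k)`
(characterized by a nondegenerate balanced pairing `φ` with `C`), and `E` is
the cokernel of `Hom_C(P1, C) → Hom_C(P2, C)` as a left `C`-module, with the
right `C`-action on `E` induced (contravariantly, via lifts of the left action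
on `DC`) by functoriality of `Ext²(-, C)`. -/
def IsRelExt : Prop :=
  ∃ (DC : Mdl Cᵐᵒᵖ) (φ : DC → C → k),
    (∀ n n' m, φ (n + n') m = φ n m + φ n' m) ∧
    (∀ n m m', φ n (m + m') = φ n m + φ n m') ∧
    (∀ (c : k) n m, φ n ((algebraMap k C c) * m) = c * φ n m) ∧
    (∀ (a : C) n m, φ (op a • n) m = φ n (a * m)) ∧
    (∀ n, (∀ m, φ n m = 0) → n = 0) ∧
    (∀ m, (∀ n, φ n m = 0) → m = 0) ∧
    ∃ (P2 P1 P0 : Mdl Cᵐᵒᵖ) (d2 : P2 →ₗ[Cᵐᵒᵖ] P1) (d1 : P1 →ₗ[Cᵐᵒᵖ] P0)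
      (d0 : P0 →ₗ[Cᵐᵒᵖ] DC),
      Module.Projective Cᵐᵒᵖ P2 ∧ Module.Projective Cᵐᵒᵖ P1 ∧
      Module.Projective Cᵐᵒᵖ P0 ∧
      Function.Injective d2 ∧ Function.Surjective d0 ∧
      LinearMap.range d2 = LinearMap.ker d1 ∧
      LinearMap.range d1 = LinearMap.ker d0 ∧
      ∃ q : (P2 →ₗ[Cᵐᵒᵖ] C) →ₗ[C] E,
        Function.Surjective q ∧
        (∀ g : P2 →ₗ[Cᵐᵒᵖ] C, q g = 0 ↔ ∃ f : P1 →ₗ[Cᵐᵒᵖ] C, g = f.comp d2) ∧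
        ∀ c : C, ∃ (μ : DC →ₗ[Cᵐᵒᵖ] DC) (f0 : P0 →ₗ[Cᵐᵒᵖ] P0)
            (f1 : P1 →ₗ[Cᵐᵒᵖ] P1) (f2 : P2 →ₗ[Cᵐᵒᵖ] P2),
          (∀ n x, φ (μ n) x = φ n (x * c)) ∧
          d0.comp f0 = μ.comp d0 ∧
          d1.comp f1 = f0.comp d1 ∧
          d2.comp f2 = f1.comp d2 ∧
          ∀ g : P2 →ₗ[Cᵐᵒᵖ] C, q (g.comp f2) = op c • q g

end RelExt



/-! ## Auxiliary material -/

section GenericLemmas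

variable {R : Type} [Ring R]

/-- Existence of projective covers over artinian rings. -/
theorem aux_exists_cover [IsArtinianRing R] (M : Type) [AddCommGroup M] [Module R M]
    [Module.Finite R M] :
    ∃ (P : Mdl R) (f : P →ₗ[R] M), Module.Finite R P ∧ Module.Projective R P ∧
      Function.Surjective f ∧ ∀ N : Submodule R P, N ⊔ LinearMap.ker f = ⊤ → N = ⊤ := by
  obtain ⟨n, f, hf⟩ := Module.Finite.exists_fin' R M
  obtain ⟨N, hN, hmin⟩ := WellFounded.has_min
    (wellFounded_lt : WellFounded (fun a b : Submodule R (Fin n → R) => a < b))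
    {N | Function.Surjective (f.domRestrict N)}
    ⟨⊤, fun m => by obtain ⟨x, hx⟩ := hf m; exact ⟨⟨x, trivial⟩, hx⟩⟩
  have hmin' : ∀ N' : Submodule R (Fin n → R), N' ≤ N →
      Function.Surjective (f.domRestrict N') → N' = N := by
    intro N' hle hs
    by_contra hne
    exact hmin N' hs (lt_of_le_of_ne hle hne)
  obtain ⟨g, hg⟩ := Module.projective_lifting_property (f.domRestrict N) f hN
  have hg' : ∀ x, f (g x : Fin n → R) = f x := fun x => LinearMap.congr_fun hg x
  have hsurj : Function.Surjective (g.comp N.subtype) := by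
    have h1 : (LinearMap.range (g.comp N.subtype)).map N.subtype = N := by
      apply hmin'
      · exact Submodule.map_subtype_le _ _
      · intro m
        obtain ⟨x, hx⟩ := hN m
        refine ⟨⟨(g x : Fin n → R), ⟨g x, ⟨x, rfl⟩, rfl⟩⟩, ?_⟩
        simpa [hg'] using hx
    intro y
    have hy : (y : Fin n → R) ∈ (LinearMap.range (g.comp N.subtype)).map N.subtype := by
      rw [h1]; exact y.2
    obtain ⟨z, ⟨w, hw⟩, hz⟩ := hy
    exact ⟨w, by rw [hw]; exact Subtype.ext hz⟩
  have hinj := IsNoetherian.injective_of_surjective_endomorphism _ hsurj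
  let e := LinearEquiv.ofBijective (g.comp N.subtype) ⟨hinj, hsurj⟩
  refine ⟨ModuleCat.of R N, f.domRestrict N, ?_, ?_, hN, ?_⟩
  · exact (inferInstance : Module.Finite R N)
  · exact Module.Projective.of_split (R := R) (P := N) (M := Fin n → R)
      (N.subtype.comp e.symm.toLinearMap) g
      (LinearMap.ext fun x => e.apply_symm_apply x)
  · intro K hK
    have h1 : K.map N.subtype = N := by
      apply hmin'
      · exact Submodule.map_subtype_le _ _
      · intro m
        obtain ⟨x, hx⟩ := hN m
        have hx' : x ∈ K ⊔ LinearMap.ker (f.domRestrict N) := by rw [hK]; trivial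
        obtain ⟨a, ha, b, hb, hab⟩ := Submodule.mem_sup.1 hx'
        refine ⟨⟨a, ⟨a, ha, rfl⟩⟩, ?_⟩
        have : f.domRestrict N a = f.domRestrict N x := by
          rw [← hab, map_add, LinearMap.mem_ker.1 hb, add_zero]
        exact this.trans hx
    rw [eq_top_iff]
    intro y _
    have hy : (y : Fin n → R) ∈ K.map N.subtype := by rw [h1]; exact y.2
    obtain ⟨z, hz, hzy⟩ := hy
    have : z = y := Subtype.ext hzy
    rwa [← this]

theorem aux_exists_minpres [IsArtinianRing R] (M : Mdl R) [Module.Finite R M] :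
    ∃ (P1 P0 : Mdl R) (d1 : P1 →ₗ[R] P0) (d0 : P0 →ₗ[R] M), IsMinPres R d1 d0 ∧
      Module.Finite R P1 ∧ Module.Finite R P0 := by
  obtain ⟨P0, d0, h1, h2, h3, h4⟩ := aux_exists_cover (R := R) M
  obtain ⟨P1, f, g1, g2, g3, g4⟩ := aux_exists_cover (R := R) (LinearMap.ker d0)
  refine ⟨P1, P0, (LinearMap.ker d0).subtype.comp f, d0, ⟨⟨h2, h3, h4⟩, g2, ?_, ?_⟩, g1, h1⟩
  · rw [LinearMap.range_comp, LinearMap.range_eq_top.2 g3]; simp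
  · intro N hN
    apply g4
    rwa [LinearMap.ker_comp_of_ker_eq_bot _ (by simp)] at hN

/-- a module with a superfluous map onto a finite module is finite -/
theorem aux_finite_of_superfluous {P M : Type} [AddCommGroup P] [Module R P] [AddCommGroup M]
    [Module R M] [Module.Finite R M] (f : P →ₗ[R] M) (hf : Function.Surjective f)
    (h : ∀ N : Submodule R P, N ⊔ LinearMap.ker f = ⊤ → N = ⊤) : Module.Finite R P := by
  obtain ⟨n, g, hg⟩ := Module.Finite.exists_fin' R M
  obtain ⟨l, hl⟩ := Module.projective_lifting_property f g hf
  have : LinearMap.range l = ⊤ := by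
    apply h
    rw [eq_top_iff]
    intro x _
    obtain ⟨y, hy⟩ := hg (f x)
    have h2 : f (l y) = f x := by rw [← hy, ← hl]; rfl
    refine Submodule.mem_sup.2 ⟨l y, ⟨y, rfl⟩, x - l y, ?_, by abel⟩
    simp [h2]
  exact Module.Finite.of_surjective l (LinearMap.range_eq_top.1 this)

theorem aux_minpres_finite [IsNoetherianRing R] {P1 P0 M : Mdl R} [Module.Finite R M]
    {d1 : P1 →ₗ[R] P0} {d0 : P0 →ₗ[R] M} (h : IsMinPres R d1 d0) :
    Module.Finite R P1 ∧ Module.Finite R P0 := by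
  obtain ⟨⟨h1, h2, h3⟩, h4, h5, h6⟩ := h
  have f0 : Module.Finite R P0 := aux_finite_of_superfluous d0 h2 h3
  refine ⟨?_, f0⟩
  refine aux_finite_of_superfluous d1.rangeRestrict d1.surjective_rangeRestrict ?_
  intro N hN
  apply h6
  rwa [LinearMap.ker_rangeRestrict] at hN

/-- lifting a map from a projective along an exact pair -/
theorem aux_lift {P X Y Z : Type} [AddCommGroup P] [Module R P] [AddCommGroup X] [Module R X]
    [AddCommGroup Y] [Module R Y] [AddCommGroup Z] [Module R Z] [Module.Projective R P]
    (f : X →ₗ[R] Y) (g : Y →ₗ[R] Z) (hfg : LinearMap.range f = LinearMap.ker g)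
    (a : P →ₗ[R] Y) (ha : g.comp a = 0) : ∃ b : P →ₗ[R] X, f.comp b = a := by
  have hmem : ∀ x, a x ∈ LinearMap.range f := fun x => by
    rw [hfg, LinearMap.mem_ker]; exact LinearMap.congr_fun ha x
  obtain ⟨b, hb⟩ := Module.projective_lifting_property f.rangeRestrict
    (a.codRestrict _ hmem) f.surjective_rangeRestrict
  refine ⟨b, ?_⟩
  ext x
  exact congrArg Subtype.val (LinearMap.congr_fun hb x)

/-- lifting along an injective map with given range -/
theorem aux_lift_inj {P X Y Z : Type} [AddCommGroup P] [Module R P] [AddCommGroup X] [Module R X]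
    [AddCommGroup Y] [Module R Y] [AddCommGroup Z] [Module R Z]
    (f : X →ₗ[R] Y) (g : Y →ₗ[R] Z) (hf : Function.Injective f)
    (hfg : LinearMap.range f = LinearMap.ker g)
    (a : P →ₗ[R] Y) (ha : g.comp a = 0) : ∃ b : P →ₗ[R] X, f.comp b = a := by
  have hmem : ∀ x, a x ∈ LinearMap.range f := fun x => by
    rw [hfg, LinearMap.mem_ker]; exact LinearMap.congr_fun ha x
  refine ⟨(LinearEquiv.ofInjective f hf).symm.toLinearMap.comp (a.codRestrict _ hmem), ?_⟩
  ext x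
  have := (LinearEquiv.ofInjective f hf).apply_symm_apply (a.codRestrict _ hmem x)
  exact congrArg Subtype.val this

/-- descending along a surjection -/
theorem aux_desc {P X Y : Type} [AddCommGroup P] [Module R P] [AddCommGroup X] [Module R X]
    [AddCommGroup Y] [Module R Y] 
    (f : X →ₗ[R] Y) (hf : Function.Surjective f)
    (a : X →ₗ[R] P) (ha : ∀ x, f x = 0 → a x = 0) : ∃ b : Y →ₗ[R] P, b.comp f = a := by
  refine ⟨((LinearMap.ker f).liftQ a (fun x hx => ha x hx)).comp
    (f.quotKerEquivOfSurjective hf).symm.toLinearMap, ?_⟩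
  ext x
  have : (f.quotKerEquivOfSurjective hf).symm (f x) = (LinearMap.ker f).mkQ x := by
    rw [LinearEquiv.symm_apply_eq]; rfl
  simp only [LinearMap.comp_apply, LinearEquiv.coe_coe, this]
  exact Submodule.liftQ_apply _ _ _

/-- Comparison of two length two resolutions. -/
theorem aux_comparison {X P2 P1 P0 Q2 Q1 Q0 : Type}
    [AddCommGroup X] [Module R X] [AddCommGroup P2] [Module R P2] [AddCommGroup P1] [Module R P1]
    [AddCommGroup P0] [Module R P0] [AddCommGroup Q2] [Module R Q2] [AddCommGroup Q1] [Module R Q1]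
    [AddCommGroup Q0] [Module R Q0]
    [Module.Projective R P1] [Module.Projective R P0]
    [Module.Projective R Q1] [Module.Projective R Q0]
    (d2 : P2 →ₗ[R] P1) (d1 : P1 →ₗ[R] P0) (d0 : P0 →ₗ[R] X)
    (e2 : Q2 →ₗ[R] Q1) (e1 : Q1 →ₗ[R] Q0) (e0 : Q0 →ₗ[R] X)
    (hd2 : Function.Injective d2) (hd0 : Function.Surjective d0)
    (hd21 : LinearMap.range d2 = LinearMap.ker d1) (hd10 : LinearMap.range d1 = LinearMap.ker d0)
    (he2 : Function.Injective e2) (he0 : Function.Surjective e0)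
    (he21 : LinearMap.range e2 = LinearMap.ker e1) (he10 : LinearMap.range e1 = LinearMap.ker e0) :
    ∃ (u2 : P2 →ₗ[R] Q2) (v2 : Q2 →ₗ[R] P2) (u1 : P1 →ₗ[R] Q1) (v1 : Q1 →ₗ[R] P1)
      (s : P1 →ₗ[R] P2) (t : Q1 →ₗ[R] Q2),
      (∀ x, e2 (u2 x) = u1 (d2 x)) ∧ (∀ x, d2 (v2 x) = v1 (e2 x)) ∧
      (∀ x, x = v2 (u2 x) + s (d2 x)) ∧ (∀ x, x = u2 (v2 x) + t (e2 x)) := by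
  have hd1d2 : ∀ x, d1 (d2 x) = 0 := fun x => by
    have : d2 x ∈ LinearMap.ker d1 := by rw [← hd21]; exact ⟨x, rfl⟩
    exact this
  have hd0d1 : ∀ x, d0 (d1 x) = 0 := fun x => by
    have : d1 x ∈ LinearMap.ker d0 := by rw [← hd10]; exact ⟨x, rfl⟩
    exact this
  have he1e2 : ∀ x, e1 (e2 x) = 0 := fun x => by
    have : e2 x ∈ LinearMap.ker e1 := by rw [← he21]; exact ⟨x, rfl⟩
    exact this
  have he0e1 : ∀ x, e0 (e1 x) = 0 := fun x => by
    have : e1 x ∈ LinearMap.ker e0 := by rw [← he10]; exact ⟨x, rfl⟩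
    exact this
  obtain ⟨u0, hu0⟩ := Module.projective_lifting_property e0 d0 he0
  obtain ⟨v0, hv0⟩ := Module.projective_lifting_property d0 e0 hd0
  replace hu0 : ∀ x, e0 (u0 x) = d0 x := LinearMap.congr_fun hu0
  replace hv0 : ∀ x, d0 (v0 x) = e0 x := LinearMap.congr_fun hv0
  obtain ⟨u1, hu1⟩ := aux_lift e1 e0 he10 (u0.comp d1) (by ext x; simp [hu0, hd0d1])
  obtain ⟨v1, hv1⟩ := aux_lift d1 d0 hd10 (v0.comp e1) (by ext x; simp [hv0, he0e1])
  replace hu1 : ∀ x, e1 (u1 x) = u0 (d1 x) := LinearMap.congr_fun hu1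
  replace hv1 : ∀ x, d1 (v1 x) = v0 (e1 x) := LinearMap.congr_fun hv1
  obtain ⟨u2, hu2⟩ := aux_lift_inj e2 e1 he2 he21 (u1.comp d2) (by ext x; simp [hu1, hd1d2])
  obtain ⟨v2, hv2⟩ := aux_lift_inj d2 d1 hd2 hd21 (v1.comp e2) (by ext x; simp [hv1, he1e2])
  replace hu2 : ∀ x, e2 (u2 x) = u1 (d2 x) := LinearMap.congr_fun hu2
  replace hv2 : ∀ x, d2 (v2 x) = v1 (e2 x) := LinearMap.congr_fun hv2
  obtain ⟨s0, hs0⟩ := aux_lift d1 d0 hd10 (LinearMap.id - v0.comp u0)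
    (by ext x; simp [hv0, hu0])
  obtain ⟨t0, ht0⟩ := aux_lift e1 e0 he10 (LinearMap.id - u0.comp v0)
    (by ext x; simp [hv0, hu0])
  replace hs0 : ∀ x, d1 (s0 x) = x - v0 (u0 x) := LinearMap.congr_fun hs0
  replace ht0 : ∀ x, e1 (t0 x) = x - u0 (v0 x) := LinearMap.congr_fun ht0
  obtain ⟨s, hs⟩ := aux_lift_inj d2 d1 hd2 hd21 (LinearMap.id - v1.comp u1 - s0.comp d1)
    (by ext x; simp [hv1, hu1, hs0])
  obtain ⟨t, ht⟩ := aux_lift_inj e2 e1 he2 he21 (LinearMap.id - u1.comp v1 - t0.comp e1)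
    (by ext x; simp [hv1, hu1, ht0])
  replace hs : ∀ x, d2 (s x) = x - v1 (u1 x) - s0 (d1 x) := LinearMap.congr_fun hs
  replace ht : ∀ x, e2 (t x) = x - u1 (v1 x) - t0 (e1 x) := LinearMap.congr_fun ht
  refine ⟨u2, v2, u1, v1, s, t, hu2, hv2, fun x => hd2 ?_, fun x => he2 ?_⟩
  · rw [map_add, hv2, hu2, hs, hd1d2]; simp
  · rw [map_add, hu2, hv2, ht, he1e2]; simp

/-- All maps `P1 → M` factor through `d`. -/
def AuxFactor {P1 P0 : Type} [AddCommGroup P1] [Module R P1] [AddCommGroup P0] [Module R P0]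
    (d : P1 →ₗ[R] P0) (M : Type) [AddCommGroup M] [Module R M] : Prop :=
  ∀ h : P1 →ₗ[R] M, ∃ hext : P0 →ₗ[R] M, ∀ x, h x = hext (d x)

/-- Factorisation implies vanishing of `Ext¹(M, X)` for `X ∈ Gen M`. -/
theorem aux_ext_of_factor {P1 P0 M X Z : Type} [AddCommGroup P1] [Module R P1] [AddCommGroup P0]
    [Module R P0] [AddCommGroup M] [Module R M] [AddCommGroup X] [Module R X]
    [AddCommGroup Z] [Module R Z] [Module.Projective R P1] [Module.Projective R P0]
    (d1 : P1 →ₗ[R] P0) (d0 : P0 →ₗ[R] M) (h10 : LinearMap.range d1 = LinearMap.ker d0)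
    (h0 : Function.Surjective d0) (hF : AuxFactor d1 M)
    (n : ℕ) (π : (Fin n → M) →ₗ[R] X) (hπ : Function.Surjective π)
    (i : X →ₗ[R] Z) (p : Z →ₗ[R] M) (hi : Function.Injective i) (hp : Function.Surjective p)
    (hip : LinearMap.range i = LinearMap.ker p) : ∃ s : M →ₗ[R] Z, ∀ m, p (s m) = m := by
  have hpi : ∀ x, p (i x) = 0 := fun x => by
    have : i x ∈ LinearMap.ker p := by rw [← hip]; exact ⟨x, rfl⟩
    exact this
  have hdd : ∀ x, d0 (d1 x) = 0 := fun x => by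
    have : d1 x ∈ LinearMap.ker d0 := by rw [← h10]; exact ⟨x, rfl⟩
    exact this
  obtain ⟨a, ha⟩ := Module.projective_lifting_property p d0 hp
  replace ha : ∀ x, p (a x) = d0 x := LinearMap.congr_fun ha
  obtain ⟨b, hb⟩ := aux_lift_inj i p hi hip (a.comp d1) (by ext x; simp [ha, hdd])
  replace hb : ∀ x, i (b x) = a (d1 x) := LinearMap.congr_fun hb
  obtain ⟨c, hc⟩ := Module.projective_lifting_property π b hπ
  replace hc : ∀ x, π (c x) = b x := LinearMap.congr_fun hc
  choose h' hh' using fun j : Fin n => hF ((LinearMap.proj j).comp c)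
  have hc' : ∀ x, c x = LinearMap.pi h' (d1 x) := by
    intro x; funext j; exact hh' j x
  obtain ⟨s, hs⟩ := aux_desc d0 h0 (a - i.comp (π.comp (LinearMap.pi h'))) (by
    intro y hy
    have : y ∈ LinearMap.range d1 := by rw [h10]; exact hy
    obtain ⟨x, rfl⟩ := this
    have h2 := hb x
    rw [← hc, hc'] at h2
    simp [h2])
  refine ⟨s, fun m => ?_⟩
  obtain ⟨y, rfl⟩ := h0 m
  have := LinearMap.congr_fun hs y
  simp only [LinearMap.comp_apply] at this
  rw [this]
  simp [hpi, ha]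

/-- Vanishing of `Ext¹(M, M/L)` gives factorisation for minimal presentations. -/
theorem aux_factor_of_ext [IsNoetherianRing R] {P1 P0 M : Type} [AddCommGroup P1] [Module R P1]
    [AddCommGroup P0] [Module R P0] [AddCommGroup M] [Module R M]
    [Module.Projective R P1] [Module.Projective R P0] [Module.Finite R P1]
    (d1 : P1 →ₗ[R] P0) (d0 : P0 →ₗ[R] M) (h10 : LinearMap.range d1 = LinearMap.ker d0)
    (h0 : Function.Surjective d0)
    (hmin : ∀ N : Submodule R P1, N ⊔ LinearMap.ker d1 = ⊤ → N = ⊤)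
    (hE : ∀ (L : Submodule R M) (Z : Type) [AddCommGroup Z] [Module R Z]
      (i : (M ⧸ L) →ₗ[R] Z) (p : Z →ₗ[R] M), Function.Injective i → Function.Surjective p →
      LinearMap.range i = LinearMap.ker p → ∃ s : M →ₗ[R] Z, ∀ m, p (s m) = m) :
    AuxFactor d1 M := by
  intro h
  have hdd : ∀ x, d0 (d1 x) = 0 := fun x => by
    have : d1 x ∈ LinearMap.ker d0 := by rw [← h10]; exact ⟨x, rfl⟩
    exact this
  let L : Submodule R M := (LinearMap.ker d1).map h
  -- the pushout
  let W : Submodule R (P0 × (M ⧸ L)) := LinearMap.range (d1.prod (-(L.mkQ.comp h)))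
  let Z := (P0 × (M ⧸ L)) ⧸ W
  let i : (M ⧸ L) →ₗ[R] Z := W.mkQ.comp (LinearMap.inr R P0 (M ⧸ L))
  let p : Z →ₗ[R] M := W.liftQ (d0.comp (LinearMap.fst R P0 (M ⧸ L))) (by
    rintro _ ⟨x, rfl⟩
    simp [hdd])
  have hi : Function.Injective i := by
    rw [← LinearMap.ker_eq_bot, LinearMap.ker_eq_bot']
    intro x hx
    have : (0, x) ∈ W := (Submodule.Quotient.mk_eq_zero W).1 hx
    obtain ⟨w, hw⟩ := this
    have h1 : d1 w = 0 := congrArg Prod.fst hw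
    have h2 : -(L.mkQ (h w)) = x := congrArg Prod.snd hw
    rw [← h2, neg_eq_zero]
    exact (Submodule.Quotient.mk_eq_zero L).2 ⟨w, h1, rfl⟩
  have hp : Function.Surjective p := by
    intro m
    obtain ⟨y, rfl⟩ := h0 m
    exact ⟨W.mkQ (y, 0), rfl⟩
  have hip : LinearMap.range i = LinearMap.ker p := by
    apply le_antisymm
    · rintro _ ⟨x, rfl⟩
      change d0 0 = 0
      simp
    · intro z hz
      obtain ⟨⟨y, x⟩, rfl⟩ := W.mkQ_surjective z
      have hy : y ∈ LinearMap.range d1 := by rw [h10]; exact hz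
      obtain ⟨w, rfl⟩ := hy
      refine ⟨x + L.mkQ (h w), ?_⟩
      change W.mkQ _ = W.mkQ _
      rw [← sub_eq_zero, ← map_sub]
      refine (Submodule.Quotient.mk_eq_zero W).2 ⟨-w, ?_⟩
      ext <;> simp
  obtain ⟨s, hs⟩ := hE L Z i p hi hp hip
  let b : P0 →ₗ[R] Z := W.mkQ.comp (LinearMap.inl R P0 (M ⧸ L))
  have hpb : ∀ y, p (b y) = d0 y := fun y => rfl
  obtain ⟨r, hr⟩ := aux_lift_inj i p hi hip (b - s.comp d0) (by ext y; simp [hpb, hs])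
  replace hr : ∀ y, i (r y) = b y - s (d0 y) := LinearMap.congr_fun hr
  have hrd : ∀ x, r (d1 x) = L.mkQ (h x) := by
    intro x
    apply hi
    rw [hr, hdd, map_zero, sub_zero]
    change W.mkQ _ = W.mkQ _
    rw [← sub_eq_zero, ← map_sub]
    refine (Submodule.Quotient.mk_eq_zero W).2 ⟨x, ?_⟩
    ext <;> simp
  obtain ⟨h2, hh2⟩ := Module.projective_lifting_property L.mkQ r L.mkQ_surjective
  replace hh2 : ∀ y, L.mkQ (h2 y) = r y := LinearMap.congr_fun hh2
  have hmem : ∀ x, (h - h2.comp d1) x ∈ L := by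
    intro x
    have : L.mkQ ((h - h2.comp d1) x) = 0 := by
      rw [LinearMap.sub_apply, map_sub, LinearMap.comp_apply, hh2, hrd, sub_self]
    exact (Submodule.Quotient.mk_eq_zero L).1 this
  let hk : LinearMap.ker d1 →ₗ[R] L := (h.domRestrict _).codRestrict L (fun x => ⟨x, x.2, rfl⟩)
  have hks : Function.Surjective hk := by
    rintro ⟨m, x, hx, rfl⟩
    exact ⟨⟨x, hx⟩, rfl⟩
  obtain ⟨t, ht⟩ := Module.projective_lifting_property hk ((h - h2.comp d1).codRestrict L hmem) hks
  replace ht : ∀ x, h (t x : P1) = h x - h2 (d1 x) := fun x =>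
    congrArg Subtype.val (LinearMap.congr_fun ht x)
  let e : P1 →ₗ[R] P1 := LinearMap.id - (LinearMap.ker d1).subtype.comp t
  have he : ∀ x, e x = x - t x := fun x => rfl
  have hes : Function.Surjective e := by
    rw [← LinearMap.range_eq_top]
    apply hmin
    rw [eq_top_iff]
    intro x _
    exact Submodule.mem_sup.2 ⟨e x, ⟨x, rfl⟩, t x, (t x).2, by rw [he]; abel⟩
  refine ⟨h2, fun x => ?_⟩
  obtain ⟨y, rfl⟩ := hes x
  have : d1 (t y : P1) = 0 := (t y).2
  rw [he, map_sub, map_sub, ht, this]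
  simp

end GenericLemmas

set_option linter.style.haveILetI false
set_option linter.unusedSectionVars false

/-- The `k`-dual of a left `A`-module, as a right `A`-module. -/
def KDual (k : Type) [Field k] (A : Type) (N : Type) [AddCommGroup N] [Module k N] : Type :=
  N →ₗ[k] k

section KDualSection

variable (k : Type) [Field k] (A : Type) [Ring A] [Algebra k A]
  (N : Type) [AddCommGroup N] [Module A N] [Module k N] [IsScalarTower k A N]

instance : AddCommGroup (KDual k A N) := inferInstanceAs (AddCommGroup (N →ₗ[k] k))

instance : Module k (KDual k A N) := inferInstanceAs (Module k (N →ₗ[k] k))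

instance : SMul Aᵐᵒᵖ (KDual k A N) :=
  ⟨fun a f => LinearMap.comp (show N →ₗ[k] k from f)
    { toFun := fun n => unop a • n
      map_add' := fun x y => smul_add _ x y
      map_smul' := fun c x => by
        rw [RingHom.id_apply, ← algebraMap_smul A c x, ← algebraMap_smul A c, ← mul_smul, ← mul_smul,
          Algebra.commutes] }⟩

/-- evaluation -/
def KDual.ev (f : KDual k A N) : N →ₗ[k] k := f

variable {k A N}

theorem KDual.ev_smul (a : Aᵐᵒᵖ) (f : KDual k A N) (n : N) :
    (a • f).ev k A N n = f.ev k A N (unop a • n) := rfl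

theorem KDual.ev_add (f g : KDual k A N) (n : N) :
    (f + g).ev k A N n = f.ev k A N n + g.ev k A N n := rfl

theorem KDual.ev_zero (n : N) : (0 : KDual k A N).ev k A N n = 0 := rfl

theorem KDual.ext' {f g : KDual k A N} (h : ∀ n, f.ev k A N n = g.ev k A N n) : f = g :=
  LinearMap.ext h

instance : Module Aᵐᵒᵖ (KDual k A N) where
  one_smul f := KDual.ext' fun n => by rw [KDual.ev_smul, unop_one, one_smul]
  mul_smul a b f := KDual.ext' fun n => by
    rw [KDual.ev_smul, KDual.ev_smul, KDual.ev_smul, unop_mul, mul_smul]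
  smul_zero a := KDual.ext' fun n => by rw [KDual.ev_smul, KDual.ev_zero, KDual.ev_zero]
  smul_add a f g := KDual.ext' fun n => by
    rw [KDual.ev_smul, KDual.ev_add, KDual.ev_add, KDual.ev_smul, KDual.ev_smul]
  add_smul a b f := KDual.ext' fun n => by
    rw [KDual.ev_smul, KDual.ev_add, KDual.ev_smul, KDual.ev_smul, MulOpposite.unop_add, add_smul, map_add]
  zero_smul f := KDual.ext' fun n => by
    rw [KDual.ev_smul, KDual.ev_zero, unop_zero, zero_smul, map_zero]

end KDualSection

section Pairing

variable (k : Type) [Field k] {A : Type} [Ring A] [Algebra k A]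

/-- A balanced pairing `M × T → k`. -/
def AuxBal (M T : Type) [AddCommGroup M] [Module Aᵐᵒᵖ M] [AddCommGroup T] [Module A T]
    (β : M → T → k) : Prop :=
  (∀ m m' t, β (m + m') t = β m t + β m' t) ∧
  (∀ m t t', β m (t + t') = β m t + β m t') ∧
  (∀ (c : k) m t, β m (algebraMap k A c • t) = c * β m t) ∧
  (∀ (a : A) m t, β (op a • m) t = β m (a • t))

/-- All balanced pairings vanish (`M ⊗ T = 0`). -/
def AuxBalZero (A : Type) [Ring A] [Algebra k A]
    (M T : Type) [AddCommGroup M] [Module Aᵐᵒᵖ M] [AddCommGroup T] [Module A T] : Prop :=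
  ∀ β : M → T → k, AuxBal k (A := A) M T β → ∀ m t, β m t = 0

/-- the dual basis lemma -/
theorem aux_dual_basis (P : Type) [AddCommGroup P] [Module Aᵐᵒᵖ P] [Module.Finite Aᵐᵒᵖ P]
    [Module.Projective Aᵐᵒᵖ P] :
    ∃ (n : ℕ) (x : Fin n → P) (g : Fin n → (P →ₗ[Aᵐᵒᵖ] A)), ∀ y, y = ∑ i, op (g i y) • x i := by
  obtain ⟨n, f, s, -, -, hfs⟩ := Module.Finite.exists_comp_eq_id_of_projective Aᵐᵒᵖ P
  let w : Aᵐᵒᵖ →ₗ[Aᵐᵒᵖ] A :=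
    { toFun := unop
      map_add' := fun _ _ => rfl
      map_smul' := fun _ _ => rfl }
  refine ⟨n, fun i => f (Pi.single i 1), fun i => w.comp ((LinearMap.proj i).comp s), fun y => ?_⟩
  have h1 : f (s y) = y := LinearMap.congr_fun hfs y
  conv_lhs => rw [← h1, pi_eq_sum_univ' (s y), map_sum]
  refine Finset.sum_congr rfl fun i _ => ?_
  rw [map_smul]
  congr 2

variable {M T P1 P0 : Type} [AddCommGroup M] [Module Aᵐᵒᵖ M] [AddCommGroup T] [Module A T]
  [AddCommGroup P1] [Module Aᵐᵒᵖ P1] [AddCommGroup P0] [Module Aᵐᵒᵖ P0]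
  [Module.Finite Aᵐᵒᵖ P1] [Module.Projective Aᵐᵒᵖ P1]

/-- the rank one map `x ↦ m · g(x)` -/
def auxRankOne (m : M) (g : P1 →ₗ[Aᵐᵒᵖ] A) : P1 →ₗ[Aᵐᵒᵖ] M where
  toFun x := op (g x) • m
  map_add' x y := by rw [map_add, MulOpposite.op_add, add_smul]
  map_smul' a x := by
    rw [map_smul, RingHom.id_apply, ← mul_smul]
    rfl

theorem aux_dual_expand {n : ℕ} {x : Fin n → P1} {g : Fin n → (P1 →ₗ[Aᵐᵒᵖ] A)}
    (hx : ∀ y, y = ∑ i, op (g i y) • x i) (f : P1 →ₗ[Aᵐᵒᵖ] A) : f = ∑ i, f (x i) • g i := by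
  ext y
  conv_lhs => rw [hx y, map_sum]
  rw [LinearMap.sum_apply]
  refine Finset.sum_congr rfl fun i _ => ?_
  rw [map_smul]
  rfl

theorem aux_bal_sum_right {β : M → T → k} (hβ : AuxBal k (A := A) M T β) {n : ℕ} (m : M)
    (t : Fin n → T) : β m (∑ i, t i) = ∑ i, β m (t i) :=
  map_sum (AddMonoidHom.mk' (β m) (hβ.2.1 m)) _ _

theorem aux_bal_sum_left {β : M → T → k} (hβ : AuxBal k (A := A) M T β) {n : ℕ} (m : Fin n → M)
    (t : T) : β (∑ i, m i) t = ∑ i, β (m i) t :=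
  map_sum (AddMonoidHom.mk' (fun m => β m t) (fun a b => hβ.1 a b t)) _ _

theorem aux_bal_of_factor [Module.Finite Aᵐᵒᵖ P0] [Module.Projective Aᵐᵒᵖ P0]
    (d : P1 →ₗ[Aᵐᵒᵖ] P0) (q : (P1 →ₗ[Aᵐᵒᵖ] A) →ₗ[A] T) (hq : Function.Surjective q)
    (hqd : ∀ g : P1 →ₗ[Aᵐᵒᵖ] A, q g = 0 ↔ ∃ f : P0 →ₗ[Aᵐᵒᵖ] A, g = f.comp d)
    (hF : AuxFactor d M) : AuxBalZero k A M T := by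
  intro β hβ m t
  obtain ⟨γ, rfl⟩ := hq t
  obtain ⟨n, x, g, hx⟩ := aux_dual_basis (A := A) P1
  obtain ⟨n', y, g', hy⟩ := aux_dual_basis (A := A) P0
  obtain ⟨h', hh'⟩ := hF (auxRankOne m γ)
  have e1 : β m (q γ) = ∑ i, β (auxRankOne m γ (x i)) (q (g i)) := by
    conv_lhs => rw [aux_dual_expand hx γ, map_sum, aux_bal_sum_right k hβ]
    refine Finset.sum_congr rfl fun i _ => ?_
    rw [map_smul, ← hβ.2.2.2]
    rfl
  have e2 : ∀ i, β (auxRankOne m γ (x i)) (q (g i)) =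
      ∑ j, β (h' (y j)) (q (g' j (d (x i)) • g i)) := by
    intro i
    rw [hh', hy (d (x i)), map_sum, aux_bal_sum_left k hβ]
    refine Finset.sum_congr rfl fun j _ => ?_
    rw [map_smul, hβ.2.2.2, ← map_smul, ← hy (d (x i))]
  rw [e1, Finset.sum_congr rfl (fun i _ => e2 i), Finset.sum_comm]
  refine Finset.sum_eq_zero fun j _ => ?_
  rw [← aux_bal_sum_right k hβ, ← map_sum]
  have e3 : ∑ i, g' j (d (x i)) • g i = (g' j).comp d :=
    (aux_dual_expand hx ((g' j).comp d)).symm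
  rw [e3, (hqd _).2 ⟨g' j, rfl⟩]
  have := hβ.2.1 (h' (y j)) 0 0
  simpa using this

theorem aux_factor_of_bal
    (d : P1 →ₗ[Aᵐᵒᵖ] P0) (q : (P1 →ₗ[Aᵐᵒᵖ] A) →ₗ[A] T) (hq : Function.Surjective q)
    (hqd : ∀ g : P1 →ₗ[Aᵐᵒᵖ] A, q g = 0 ↔ ∃ f : P0 →ₗ[Aᵐᵒᵖ] A, g = f.comp d)
    (hB : AuxBalZero k A M T) : AuxFactor d M := by
  letI : Module k M := Module.compHom M (algebraMap k Aᵐᵒᵖ)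
  haveI : IsScalarTower k Aᵐᵒᵖ M := IsScalarTower.of_algebraMap_smul fun r x => rfl
  haveI : SMulCommClass Aᵐᵒᵖ k M := IsScalarTower.to_smulCommClass'
  intro h
  by_contra hcon
  let V : Submodule k (P1 →ₗ[Aᵐᵒᵖ] M) :=
    { carrier := {h | ∃ h' : P0 →ₗ[Aᵐᵒᵖ] M, h = h'.comp d}
      add_mem' := by
        rintro _ _ ⟨a, rfl⟩ ⟨b, rfl⟩
        exact ⟨a + b, rfl⟩
      zero_mem' := ⟨0, rfl⟩
      smul_mem' := by
        rintro c _ ⟨a, rfl⟩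
        exact ⟨c • a, rfl⟩ }
  have hV : h ∉ V := by
    rintro ⟨h', rfl⟩
    exact hcon ⟨h', fun x => rfl⟩
  obtain ⟨Θ, hΘ, hΘV⟩ := Submodule.exists_dual_map_eq_bot_of_notMem hV inferInstance
  have hΘ0 : ∀ h' : P0 →ₗ[Aᵐᵒᵖ] M, Θ (h'.comp d) = 0 := by
    intro h'
    have : Θ (h'.comp d) ∈ V.map Θ := ⟨_, ⟨h', rfl⟩, rfl⟩
    rw [hΘV] at this
    exact this
  have r1 : ∀ (m : M) (g g' : P1 →ₗ[Aᵐᵒᵖ] A),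
      auxRankOne m (g + g') = auxRankOne m g + auxRankOne m g' := by
    intro m g g'; ext x
    change op (g x + g' x) • m = op (g x) • m + op (g' x) • m
    rw [MulOpposite.op_add, add_smul]
  have r2 : ∀ (m m' : M) (g : P1 →ₗ[Aᵐᵒᵖ] A),
      auxRankOne (m + m') g = auxRankOne m g + auxRankOne m' g := by
    intro m m' g; ext x
    exact smul_add _ _ _
  have r3 : ∀ (m : M) (a : A) (g : P1 →ₗ[Aᵐᵒᵖ] A),
      auxRankOne (op a • m) g = auxRankOne m (a • g) := by
    intro m a g; ext x
    change op (g x) • op a • m = op (a * g x) • m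
    rw [op_mul, mul_smul]
  have r4 : ∀ (m : M) (c : k) (g : P1 →ₗ[Aᵐᵒᵖ] A),
      auxRankOne m (algebraMap k A c • g) = c • auxRankOne m g := by
    intro m c g; ext x
    change op (algebraMap k A c * g x) • m = op (algebraMap k A c) • op (g x) • m
    rw [← mul_smul, ← op_mul, Algebra.commutes]
  have r5 : ∀ (m : M) (g : P1 →ₗ[Aᵐᵒᵖ] A), q g = 0 → Θ (auxRankOne m g) = 0 := by
    intro m g hg
    obtain ⟨f, rfl⟩ := (hqd g).1 hg
    exact hΘ0 (auxRankOne m f)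
  have r6 : ∀ (m : M) (g g' : P1 →ₗ[Aᵐᵒᵖ] A), q g = q g' →
      Θ (auxRankOne m g) = Θ (auxRankOne m g') := by
    intro m g g' hg
    have h1 : q (g - g') = 0 := by rw [map_sub, hg, sub_self]
    have h2 := r1 m (g - g') g'
    rw [sub_add_cancel] at h2
    rw [h2, map_add, r5 m _ h1, zero_add]
  let σ := Function.surjInv hq
  have hσ : ∀ t, q (σ t) = t := Function.surjInv_eq hq
  let β : M → T → k := fun m t => Θ (auxRankOne m (σ t))
  have hβq : ∀ m g, β m (q g) = Θ (auxRankOne m g) := fun m g => r6 m _ _ (hσ _)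
  have hβ : AuxBal k (A := A) M T β := by
    refine ⟨fun m m' t => ?_, fun m t t' => ?_, fun c m t => ?_, fun a m t => ?_⟩
    · change Θ _ = Θ _ + Θ _
      rw [r2, map_add]
    · obtain ⟨g, rfl⟩ := hq t
      obtain ⟨g', rfl⟩ := hq t'
      rw [← map_add, hβq, hβq, hβq, r1, map_add]
    · obtain ⟨g, rfl⟩ := hq t
      rw [← map_smul, hβq, hβq, r4, map_smul, smul_eq_mul]
    · obtain ⟨g, rfl⟩ := hq t
      rw [← map_smul, hβq, hβq, r3]
  have hz := hB β hβ
  obtain ⟨n, x, g, hx⟩ := aux_dual_basis (A := A) P1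
  have hh : h = ∑ i, auxRankOne (h (x i)) (g i) := by
    ext y
    conv_lhs => rw [hx y, map_sum]
    rw [LinearMap.sum_apply]
    refine Finset.sum_congr rfl fun i _ => ?_
    rw [map_smul]
    rfl
  apply hΘ
  rw [hh, map_sum]
  refine Finset.sum_eq_zero fun i _ => ?_
  rw [← hβq]
  exact hz _ _

end Pairing

section TauLemmas

variable (k : Type) [Field k] (A : Type) [Ring A] [Algebra k A]

theorem aux_factor_of_tauRigid (M : Mdl Aᵐᵒᵖ) (hM : TauRigid k A M)
    {P1 P0 : Mdl Aᵐᵒᵖ} (d1 : P1 →ₗ[Aᵐᵒᵖ] P0) (d0 : P0 →ₗ[Aᵐᵒᵖ] M) (h : IsMinPres Aᵐᵒᵖ d1 d0)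
    [Module.Finite Aᵐᵒᵖ P1] : AuxFactor d1 M := by
  haveI := h.2.1
  let V : Submodule A (P1 →ₗ[Aᵐᵒᵖ] A) :=
    { carrier := {h | ∃ h' : P0 →ₗ[Aᵐᵒᵖ] A, h = h'.comp d1}
      add_mem' := by
        rintro _ _ ⟨a, rfl⟩ ⟨b, rfl⟩
        exact ⟨a + b, rfl⟩
      zero_mem' := ⟨0, rfl⟩
      smul_mem' := by
        rintro c _ ⟨a, rfl⟩
        exact ⟨c • a, rfl⟩ }
  let Tr := (P1 →ₗ[Aᵐᵒᵖ] A) ⧸ V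
  have hq : ∀ g : P1 →ₗ[Aᵐᵒᵖ] A, V.mkQ g = 0 ↔ ∃ f : P0 →ₗ[Aᵐᵒᵖ] A, g = f.comp d1 := by
    intro g
    exact Submodule.Quotient.mk_eq_zero V
  refine aux_factor_of_bal k d1 V.mkQ V.mkQ_surjective hq ?_
  intro β hβ m t
  have hT : IsTau k A M (ModuleCat.of Aᵐᵒᵖ (KDual k A Tr)) := by
    refine ⟨P1, P0, d1, d0, h, ModuleCat.of A Tr, V.mkQ, V.mkQ_surjective, hq,
      fun f t => KDual.ev k A Tr f t, ?_, ?_, ?_, ?_, ?_, ?_⟩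
    · intro n n' m; rfl
    · intro n m m'; exact map_add _ _ _
    · intro c n m
      exact (congrArg (KDual.ev k A Tr n) (algebraMap_smul A c (m : Tr))).trans
        (map_smul (KDual.ev k A Tr n) c m)
    · intro a n m; rfl
    · intro n hn; exact KDual.ext' hn
    · intro m hm
      exact (Module.forall_dual_apply_eq_zero_iff k (m : Tr)).1 hm
  let F : M →ₗ[Aᵐᵒᵖ] KDual k A Tr :=
    { toFun := fun m =>
        ({ toFun := β m
           map_add' := hβ.2.1 m
           map_smul' := fun c t =>
             (congrArg (β m) (algebraMap_smul A c t).symm).trans (hβ.2.2.1 c m t) } : Tr →ₗ[k] k)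
      map_add' := fun m m' => KDual.ext' fun t => hβ.1 m m' t
      map_smul' := fun a m => KDual.ext' fun t => hβ.2.2.2 (unop a) m t }
  have := hM _ hT F
  have h2 : KDual.ev k A Tr (F m) t = 0 := by rw [this]; rfl
  exact h2

theorem aux_tauRigid_of_factor [IsNoetherianRing Aᵐᵒᵖ] (M : Mdl Aᵐᵒᵖ) [Module.Finite Aᵐᵒᵖ M]
    (hM : ∀ (P1 P0 : Mdl Aᵐᵒᵖ) (d1 : P1 →ₗ[Aᵐᵒᵖ] P0) (d0 : P0 →ₗ[Aᵐᵒᵖ] M),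
      IsMinPres Aᵐᵒᵖ d1 d0 → AuxFactor d1 M) : TauRigid k A M := by
  rintro T ⟨P1, P0, d1, d0, h, Tr, q, hq, hqd, φ, h1, h2, h3, h4, h5, h6⟩ f
  obtain ⟨f1, f0⟩ := aux_minpres_finite h
  haveI := h.2.1
  haveI := h.1.1
  have hb := aux_bal_of_factor k d1 q hq hqd (hM _ _ d1 d0 h)
  ext m
  apply h5
  intro t
  refine hb (fun m t => φ (f m) t) ⟨?_, ?_, ?_, ?_⟩ m t
  · intro m m' t
    change φ (f (m + m')) t = _
    rw [map_add, h1]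
  · intro m t t'; exact h2 _ _ _
  · intro c m t; exact h3 _ _ _
  · intro a m t
    change φ (f (op a • m)) t = _
    rw [map_smul, h4]

end TauLemmas

section InjDim

variable {R : Type} [Ring R]

theorem aux_factor_of_idLE1 (M : Mdl R) (hM : IdLE1 R M) {Q2 Q1 Q0 : Type}
    [AddCommGroup Q2] [Module R Q2] [AddCommGroup Q1] [Module R Q1]
    [AddCommGroup Q0] [Module R Q0] [Module.Projective R Q0]
    (e2 : Q2 →ₗ[R] Q1) (e1 : Q1 →ₗ[R] Q0)
    (he2 : Function.Injective e2)
    (he21 : LinearMap.range e2 = LinearMap.ker e1) : AuxFactor e2 M := by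
  obtain ⟨I0, I1, d0, d1, hI0, hI1, hd0, hd1, hd⟩ := hM
  intro h
  have hee : ∀ x, e1 (e2 x) = 0 := fun x => by
    have : e2 x ∈ LinearMap.ker e1 := by rw [← he21]; exact ⟨x, rfl⟩
    exact this
  have hdd : ∀ x, d1 (d0 x) = 0 := fun x => by
    have : d0 x ∈ LinearMap.ker d1 := by rw [← hd]; exact ⟨x, rfl⟩
    exact this
  obtain ⟨g, hg⟩ := Module.Injective.out (R := R) e2 he2 (d0.comp h)
  obtain ⟨b, hb⟩ := aux_desc e1.rangeRestrict e1.surjective_rangeRestrict (d1.comp g) (by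
    intro x hx
    have : x ∈ LinearMap.range e2 := by
      rw [he21]; exact congrArg Subtype.val hx
    obtain ⟨y, rfl⟩ := this
    simp [hg, hdd])
  replace hb : ∀ x, b (e1.rangeRestrict x) = d1 (g x) := LinearMap.congr_fun hb
  obtain ⟨b', hb'⟩ := Module.Injective.out (R := R) (LinearMap.range e1).subtype
    (Submodule.subtype_injective _) b
  obtain ⟨g', hg'⟩ := Module.projective_lifting_property d1 b' hd1
  replace hg' : ∀ x, d1 (g' x) = b' x := LinearMap.congr_fun hg'
  obtain ⟨h', hh'⟩ := aux_lift_inj d0 d1 hd0 hd (g - g'.comp e1) (by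
    ext x
    have h1 := hb x
    have h2 := hb' (e1.rangeRestrict x)
    have h3 : b' (e1 x) = d1 (g x) := h2.trans h1
    simp [hg', h3])
  replace hh' : ∀ x, d0 (h' x) = g x - g' (e1 x) := LinearMap.congr_fun hh'
  refine ⟨h', fun x => hd0 ?_⟩
  rw [hh', hee, hg]
  simp

open CategoryTheory Abelian

/-- a short exact sequence in `ModuleCat` from linear maps -/
theorem aux_shortExact {X Y Z : Type} [AddCommGroup X] [Module R X] [AddCommGroup Y] [Module R Y]
    [AddCommGroup Z] [Module R Z] (f : X →ₗ[R] Y) (g : Y →ₗ[R] Z) (hf : Function.Injective f)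
    (hg : Function.Surjective g) (h : LinearMap.range f = LinearMap.ker g) :
    ∃ w, (ShortComplex.mk (ModuleCat.ofHom f) (ModuleCat.ofHom g) w).ShortExact := by
  have w : ModuleCat.ofHom f ≫ ModuleCat.ofHom g = 0 := by
    ext x
    have : f x ∈ LinearMap.ker g := by rw [← h]; exact ⟨x, rfl⟩
    exact this
  refine ⟨w, ?_⟩
  haveI : Mono (ModuleCat.ofHom f) := (ModuleCat.mono_iff_injective _).2 hf
  haveI : Epi (ModuleCat.ofHom g) := (ModuleCat.epi_iff_surjective _).2 hg
  refine ShortComplex.ShortExact.mk ?_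
  exact (ShortComplex.moduleCat_exact_iff_range_eq_ker _).2 h

theorem aux_ext_zero_of_proj (P : Type) [AddCommGroup P] [Module R P] [Module.Projective R P]
    (Y : Mdl R) (n : ℕ) (x : Ext (ModuleCat.of R P) Y (n + 1)) : x = 0 := by
  haveI : Projective (ModuleCat.of R P) := (IsProjective.iff_projective P).1 inferInstance
  exact x.eq_zero_of_projective

/-- dimension shift -/
theorem aux_ext_shift {X Y Z : Type} [AddCommGroup X] [Module R X] [AddCommGroup Y] [Module R Y]
    [AddCommGroup Z] [Module R Z] (f : X →ₗ[R] Y) (g : Y →ₗ[R] Z) (hf : Function.Injective f)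
    (hg : Function.Surjective g) (h : LinearMap.range f = LinearMap.ker g)
    [Module.Projective R Y] (M : Mdl R) (n : ℕ) 
    (hX : ∀ x : Ext (ModuleCat.of R X) M (n + 1), x = 0) 
    (z : Ext (ModuleCat.of R Z) M (n + 2)) : z = 0 := by
  obtain ⟨w, hS⟩ := aux_shortExact f g hf hg h
  obtain ⟨x, rfl⟩ := Ext.contravariant_sequence_exact₃ hS M z
    (aux_ext_zero_of_proj Y M (n + 1) _) (n₀ := n + 1) (by omega)
  have hx : x = 0 := hX x
  rw [hx, Ext.comp_zero]

theorem aux_ext_one {X Y Z : Type} [AddCommGroup X] [Module R X] [AddCommGroup Y] [Module R Y]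
    [AddCommGroup Z] [Module R Z] (f : X →ₗ[R] Y) (g : Y →ₗ[R] Z) (hf : Function.Injective f)
    (hg : Function.Surjective g) (h : LinearMap.range f = LinearMap.ker g)
    [Module.Projective R Y] (M : Mdl R) 
    (hX : AuxFactor f M) 
    (z : Ext (ModuleCat.of R Z) M 1) : z = 0 := by
  obtain ⟨w, hS⟩ := aux_shortExact f g hf hg h
  obtain ⟨x, rfl⟩ := Ext.contravariant_sequence_exact₃ hS M z
    (aux_ext_zero_of_proj Y M 0 _) (n₀ := 0) (by omega)
  obtain ⟨a, rfl⟩ := Ext.addEquiv₀.symm.surjective x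
  obtain ⟨b, hb⟩ := hX a.hom
  have : a = ModuleCat.ofHom f ≫ ModuleCat.ofHom b := by
    ext x; exact hb x
  rw [this]
  have h2 := hS.extClass_comp_assoc (Ext.mk₀ (ModuleCat.ofHom b)) (n := 0) (n' := 1) (h := rfl)
  simpa [Ext.addEquiv₀] using h2

theorem aux_ext_two {X Q2 Q1 Q0 : Type}
    [AddCommGroup X] [Module R X] [AddCommGroup Q2] [Module R Q2] [AddCommGroup Q1] [Module R Q1]
    [AddCommGroup Q0] [Module R Q0] [Module.Projective R Q0] [Module.Projective R Q1]
    (e2 : Q2 →ₗ[R] Q1) (e1 : Q1 →ₗ[R] Q0) (e0 : Q0 →ₗ[R] X)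
    (he2 : Function.Injective e2) (he0 : Function.Surjective e0)
    (he21 : LinearMap.range e2 = LinearMap.ker e1)
    (he10 : LinearMap.range e1 = LinearMap.ker e0) (M : Mdl R) (hF : AuxFactor e2 M)
    (z : Ext (ModuleCat.of R X) M 2) : z = 0 := by
  refine aux_ext_shift (LinearMap.ker e0).subtype e0 (Submodule.subtype_injective _) he0
    (by simp) M 0 ?_ z
  have hm : ∀ x, e1 x ∈ LinearMap.ker e0 := fun x => by rw [← he10]; exact ⟨x, rfl⟩
  refine aux_ext_one e2 (e1.codRestrict _ hm) he2 ?_ ?_ M hF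
  · rintro ⟨y, hy⟩
    rw [← he10] at hy
    obtain ⟨x, hx⟩ := hy
    exact ⟨x, Subtype.ext hx⟩
  · rw [he21, LinearMap.ker_codRestrict]

theorem aux_ext_three (X : Mdl R) (hX : PdLE2 R X) (M : Mdl R)
    (z : Ext (ModuleCat.of R X) M 3) : z = 0 := by
  obtain ⟨Q2, Q1, Q0, e2, e1, e0, p2, p1, p0, he2, he0, he21, he10⟩ := hX
  refine aux_ext_shift (LinearMap.ker e0).subtype e0 (Submodule.subtype_injective _) he0
    (by simp) M 1 ?_ z
  have hm : ∀ x, e1 x ∈ LinearMap.ker e0 := fun x => by rw [← he10]; exact ⟨x, rfl⟩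
  refine aux_ext_shift e2 (e1.codRestrict _ hm) he2 ?_ ?_ M 0 ?_
  · rintro ⟨y, hy⟩
    rw [← he10] at hy
    obtain ⟨x, hx⟩ := hy
    exact ⟨x, Subtype.ext hx⟩
  · rw [he21, LinearMap.ker_codRestrict]
  · exact aux_ext_zero_of_proj _ M 0

theorem aux_injective_of_ext (I : Type) [AddCommGroup I] [Module R I]
    (hext : ∀ (J : Ideal R) (z : Ext (ModuleCat.of R (R ⧸ J)) (ModuleCat.of R I) 1), z = 0) :
    Module.Injective R I := by
  refine Module.Baer.injective ?_
  intro J f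
  obtain ⟨w', hS'⟩ := aux_shortExact (R := R) J.subtype J.mkQ (Submodule.subtype_injective _)
    (Submodule.mkQ_surjective _) (by simp)
  obtain ⟨y, hy⟩ := Ext.contravariant_sequence_exact₁ hS' (ModuleCat.of R I)
    (Ext.mk₀ (ModuleCat.ofHom f)) (n₁ := 1) (by omega) (hext J _)
  obtain ⟨g, rfl⟩ := Ext.addEquiv₀.symm.surjective y
  have hg : ModuleCat.ofHom J.subtype ≫ g = ModuleCat.ofHom f := by
    apply Ext.addEquiv₀.symm.injective
    simpa [Ext.addEquiv₀] using hy
  refine ⟨g.hom, fun x hx => ?_⟩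
  exact LinearMap.congr_fun (congrArg ModuleCat.Hom.hom hg) ⟨x, hx⟩

theorem aux_ext_cosyz {M I Q : Type} [AddCommGroup M] [Module R M] [AddCommGroup I] [Module R I]
    [AddCommGroup Q] [Module R Q] (f : M →ₗ[R] I) (g : I →ₗ[R] Q) (hf : Function.Injective f)
    (hg : Function.Surjective g) (h : LinearMap.range f = LinearMap.ker g)
    [Module.Injective R I] (N : Mdl R)
    (hN : ∀ z : Ext N (ModuleCat.of R M) 2, z = 0) (z : Ext N (ModuleCat.of R Q) 1) : z = 0 := by
  obtain ⟨w, hS⟩ := aux_shortExact f g hf hg h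
  obtain ⟨y, hy⟩ := Ext.covariant_sequence_exact₃ N hS z (n₁ := 2) (by omega) (hN _)
  haveI : Injective (ModuleCat.of R I) := Module.injective_object_of_injective_module R I
  have hy0 : y = 0 := Ext.eq_zero_of_injective (I := ModuleCat.of R I) y
  rw [← hy, hy0, Ext.zero_comp]

theorem aux_exists_inj (M : Mdl R) : ∃ (I0 : Mdl R) (d0 : M →ₗ[R] I0),
    Function.Injective d0 ∧ Module.Injective R I0 := by
  obtain ⟨⟨J, hJ, f, hf⟩⟩ := EnoughInjectives.presentation (C := Mdl R) M
  haveI : Injective (ModuleCat.of R J) := hJ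
  exact ⟨J, f.hom, (ModuleCat.mono_iff_injective f).1 hf,
    Module.injective_module_of_injective_object R J⟩

theorem aux_idLE1_of_factor (hgl : GlDimLE2 R) {X Q2 Q1 Q0 : Type}
    [AddCommGroup X] [Module R X] [AddCommGroup Q2] [Module R Q2] [AddCommGroup Q1] [Module R Q1]
    [AddCommGroup Q0] [Module R Q0] [Module.Projective R Q0] [Module.Projective R Q1]
    (e2 : Q2 →ₗ[R] Q1) (e1 : Q1 →ₗ[R] Q0) (e0 : Q0 →ₗ[R] X)
    (he2 : Function.Injective e2) (he0 : Function.Surjective e0)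
    (he21 : LinearMap.range e2 = LinearMap.ker e1)
    (he10 : LinearMap.range e1 = LinearMap.ker e0)
    (hcog : ∀ (N : Type) [AddCommGroup N] [Module R N] [Module.Finite R N],
      ∃ (n : ℕ) (j : N →ₗ[R] (Fin n → X)), Function.Injective j)
    (M : Mdl R) (hF : AuxFactor e2 M) : IdLE1 R M := by
  -- `Ext²(N, M) = 0` for finite `N`
  have key : ∀ (N : Type) [AddCommGroup N] [Module R N] [Module.Finite R N]
      (z : Ext (ModuleCat.of R N) M 2), z = 0 := by
    intro N _ _ _ z
    obtain ⟨n, j, hj⟩ := hcog N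
    haveI : Module.Projective R (Fin n → Q0) :=
      Module.Projective.of_equiv (DFinsupp.linearEquivFunOnFintype (R := R) (M := fun _ : Fin n => Q0))
    haveI : Module.Projective R (Fin n → Q1) :=
      Module.Projective.of_equiv (DFinsupp.linearEquivFunOnFintype (R := R) (M := fun _ : Fin n => Q1))
    have hD : ∀ z : Ext (ModuleCat.of R (Fin n → X)) M 2, z = 0 := by
      refine aux_ext_two (e2.compLeft (Fin n)) (e1.compLeft (Fin n)) (e0.compLeft (Fin n))
        ?_ ?_ ?_ ?_ M ?_
      · intro x y hxy
        funext i
        exact he2 (congrFun hxy i)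
      · intro y
        choose x hx using fun i => he0 (y i)
        exact ⟨x, funext hx⟩
      · ext y
        constructor
        · rintro ⟨x, rfl⟩
          funext i
          have : e2 (x i) ∈ LinearMap.ker e1 := by rw [← he21]; exact ⟨_, rfl⟩
          exact this
        · intro hy
          have : ∀ i, ∃ x, e2 x = y i := fun i => by
            have : y i ∈ LinearMap.range e2 := by rw [he21]; exact congrFun hy i
            exact this
          choose x hx using this
          exact ⟨x, funext hx⟩
      · ext y
        constructor
        · rintro ⟨x, rfl⟩
          funext i
          have : e1 (x i) ∈ LinearMap.ker e0 := by rw [← he10]; exact ⟨_, rfl⟩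
          exact this
        · intro hy
          have : ∀ i, ∃ x, e1 x = y i := fun i => by
            have : y i ∈ LinearMap.range e1 := by rw [he10]; exact congrFun hy i
            exact this
          choose x hx using this
          exact ⟨x, funext hx⟩
      · intro h
        choose h' hh' using fun i => hF (h.comp (LinearMap.single R (fun _ => Q2) i))
        refine ⟨∑ i, (h' i).comp (LinearMap.proj i), fun x => ?_⟩
        rw [LinearMap.sum_apply]
        conv_lhs => rw [← Finset.univ_sum_single x, map_sum]
        refine Finset.sum_congr rfl fun i _ => ?_
        exact hh' i (x i)
    obtain ⟨w, hS⟩ := aux_shortExact j (LinearMap.range j).mkQ hj (Submodule.mkQ_surjective _)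
      (by simp)
    obtain ⟨y, hy⟩ := Ext.contravariant_sequence_exact₁ hS M z (n₁ := 3) (by omega)
      (aux_ext_three (ModuleCat.of R ((Fin n → X) ⧸ LinearMap.range j)) (hgl _) M _)
    have hy0 : y = 0 := hD y
    rw [← hy, hy0, Ext.comp_zero]
  -- embed `M` in an injective module
  obtain ⟨I0, d0, hd0, hI0⟩ := aux_exists_inj M
  have hI1 : Module.Injective R (I0 ⧸ LinearMap.range d0) := by
    refine aux_injective_of_ext _ fun J => ?_
    exact aux_ext_cosyz d0 (LinearMap.range d0).mkQ hd0 (Submodule.mkQ_surjective _) (by simp)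
      (ModuleCat.of R (R ⧸ J)) (key (R ⧸ J))
  exact ⟨I0, ModuleCat.of R (I0 ⧸ LinearMap.range d0), d0, (LinearMap.range d0).mkQ,
    hI0, hI1, hd0, Submodule.mkQ_surjective _, by simp⟩

end InjDim

section CoindSection

variable (k : Type) [Field k] {C : Type} [Ring C] [Algebra k C]

/-- the map `n ↦ (c ↦ l (n c))` -/
def auxCoind {N : Type} [AddCommGroup N] [Module Cᵐᵒᵖ N] [Module k N] [IsScalarTower k Cᵐᵒᵖ N]
    (l : N →ₗ[k] k) : N →ₗ[Cᵐᵒᵖ] KDual k C C where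
  toFun n := show C →ₗ[k] k from
    { toFun := fun c => l (op c • n)
      map_add' := fun x y => by rw [MulOpposite.op_add, add_smul, map_add]
      map_smul' := fun a x => by
        rw [MulOpposite.op_smul, smul_assoc, map_smul, RingHom.id_apply] }
  map_add' x y := KDual.ext' fun c => by
    change l (op c • (x + y)) = l (op c • x) + l (op c • y)
    rw [smul_add, map_add]
  map_smul' a x := KDual.ext' fun c => by
    change l (op c • a • x) = l (op (unop a • c) • x)
    rw [← mul_smul]
    rfl

theorem auxCoind_ev {N : Type} [AddCommGroup N] [Module Cᵐᵒᵖ N] [Module k N]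
    [IsScalarTower k Cᵐᵒᵖ N] (l : N →ₗ[k] k) (n : N) (c : C) :
    (auxCoind k l n).ev k C C c = l (op c • n) := rfl

theorem aux_kdual_smul (a : k) (f : KDual k C C) : algebraMap k Cᵐᵒᵖ a • f = a • f := by
  refine KDual.ext' fun c => ?_
  change f.ev k C C ((algebraMap k C a) • c) = a • f.ev k C C c
  rw [algebraMap_smul, map_smul]

instance : IsScalarTower k Cᵐᵒᵖ (KDual k C C) :=
  IsScalarTower.of_algebraMap_smul (aux_kdual_smul k)

theorem aux_kdual_surj [FiniteDimensional k C] {X : Type} [AddCommGroup X] [Module Cᵐᵒᵖ X]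
    (f : X →ₗ[Cᵐᵒᵖ] KDual k C C) (h : ∀ c, (∀ x, (f x).ev k C C c = 0) → c = 0) :
    Function.Surjective f := by
  let W : Submodule k (Module.Dual k C) := (LinearMap.range f).restrictScalars k
  have hW : W.dualCoannihilator = ⊥ := by
    rw [eq_bot_iff]
    intro c hc
    rw [Submodule.mem_dualCoannihilator] at hc
    exact h c fun x => hc _ ⟨x, rfl⟩
  have h2 : W = ⊤ := by
    rw [← Subspace.dualCoannihilator_dualAnnihilator_eq (W := W), hW,
      Submodule.dualAnnihilator_bot]
  intro y
  have : (y : Module.Dual k C) ∈ W := by rw [h2]; trivial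
  exact this

instance [FiniteDimensional k C] : Module.Finite Cᵐᵒᵖ (KDual k C C) :=
  haveI : Module.Finite k (KDual k C C) := inferInstanceAs (Module.Finite k (C →ₗ[k] k))
  Module.Finite.of_restrictScalars_finite k Cᵐᵒᵖ _

instance [FiniteDimensional k C] : Module.Finite k Cᵐᵒᵖ :=
  Module.Finite.equiv (opLinearEquiv k : C ≃ₗ[k] Cᵐᵒᵖ)

theorem aux_artinian_op [FiniteDimensional k C] : IsArtinianRing Cᵐᵒᵖ :=
  IsArtinianRing.of_finite k Cᵐᵒᵖ

/-- finitely generated right modules embed in a power of `DC` -/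
theorem aux_cog [FiniteDimensional k C] (N : Type) [AddCommGroup N] [Module Cᵐᵒᵖ N]
    [Module.Finite Cᵐᵒᵖ N] :
    ∃ (n : ℕ) (j : N →ₗ[Cᵐᵒᵖ] (Fin n → KDual k C C)), Function.Injective j := by
  letI : Module k N := Module.compHom N (algebraMap k Cᵐᵒᵖ)
  haveI : IsScalarTower k Cᵐᵒᵖ N := IsScalarTower.of_algebraMap_smul fun r x => rfl
  haveI : Module.Finite k N := Module.Finite.trans Cᵐᵒᵖ N
  let b := Module.finBasis k N
  refine ⟨Module.finrank k N, LinearMap.pi fun i => auxCoind k (b.coord i), ?_⟩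
  rw [← LinearMap.ker_eq_bot, eq_bot_iff]
  intro x hx
  have h1 : ∀ i, b.coord i x = 0 := fun i => by
    have h2 : auxCoind (C := C) k (b.coord i) x = 0 := congrFun hx i
    have h3 := auxCoind_ev k (b.coord i) x (1 : C)
    rw [h2, KDual.ev_zero, op_one, one_smul] at h3
    exact h3.symm
  exact (b.forall_coord_eq_zero_iff).1 h1

/-- faithful modules generate `DC` -/
theorem aux_gen [FiniteDimensional k C] (N : Type) [AddCommGroup N] [Module Cᵐᵒᵖ N]
    [Module.Finite Cᵐᵒᵖ N] (hN : ∀ c : C, (∀ m : N, op c • m = 0) → c = 0) :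
    ∃ (n : ℕ) (j : (Fin n → N) →ₗ[Cᵐᵒᵖ] KDual k C C), Function.Surjective j := by
  letI : Module k N := Module.compHom N (algebraMap k Cᵐᵒᵖ)
  haveI : IsScalarTower k Cᵐᵒᵖ N := IsScalarTower.of_algebraMap_smul fun r x => rfl
  haveI : Module.Finite k N := Module.Finite.trans Cᵐᵒᵖ N
  let b := Module.finBasis k N
  refine ⟨Module.finrank k N,
    LinearMap.lsum Cᵐᵒᵖ (fun _ => N) ℕ fun i => auxCoind k (b.coord i), ?_⟩
  refine aux_kdual_surj k _ fun c hc => hN c fun m => ?_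
  refine (b.forall_coord_eq_zero_iff).1 fun i => ?_
  have h := hc (Pi.single i m)
  rw [LinearMap.lsum_piSingle] at h
  exact h

end CoindSection

theorem aux_relext (k : Type) [Field k] (C : Type) [Ring C] [Algebra k C] [FiniteDimensional k C]
    (E : Type) [AddCommGroup E] [Module C E] [Module Cᵐᵒᵖ E] (hE : IsRelExt k C E) :
    ∃ (Q2 Q1 Q0 : Mdl Cᵐᵒᵖ) (e2 : Q2 →ₗ[Cᵐᵒᵖ] Q1) (e1 : Q1 →ₗ[Cᵐᵒᵖ] Q0)
      (e0 : Q0 →ₗ[Cᵐᵒᵖ] KDual k C C) (q : (Q2 →ₗ[Cᵐᵒᵖ] C) →ₗ[C] E),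
      (Module.Finite Cᵐᵒᵖ Q2 ∧ Module.Finite Cᵐᵒᵖ Q1 ∧ Module.Finite Cᵐᵒᵖ Q0) ∧
      (Module.Projective Cᵐᵒᵖ Q2 ∧ Module.Projective Cᵐᵒᵖ Q1 ∧ Module.Projective Cᵐᵒᵖ Q0) ∧
      Function.Injective e2 ∧ Function.Surjective e0 ∧
      LinearMap.range e2 = LinearMap.ker e1 ∧ LinearMap.range e1 = LinearMap.ker e0 ∧
      Function.Surjective q ∧
      (∀ g : Q2 →ₗ[Cᵐᵒᵖ] C, q g = 0 ↔ ∃ f : Q1 →ₗ[Cᵐᵒᵖ] C, g = f.comp e2) := by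
  obtain ⟨DC, φ, h1, h2, h3, h4, h5, h6, P2, P1, P0, d2, d1, d0, p2, p1, p0, hd2, hd0, hd21, hd10,
    q, hq, hqd, -⟩ := hE
  haveI : IsArtinianRing Cᵐᵒᵖ := aux_artinian_op k
  -- identify `DC`
  let ε : DC →ₗ[Cᵐᵒᵖ] KDual k C C :=
    { toFun := fun n => show C →ₗ[k] k from
        { toFun := φ n
          map_add' := h2 n
          map_smul' := fun a c => by
            rw [Algebra.smul_def, h3]; rfl }
      map_add' := fun x y => KDual.ext' (h1 x y)
      map_smul' := fun a x => KDual.ext' (h4 (unop a) x) }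
  have hεi : Function.Injective ε := by
    rw [← LinearMap.ker_eq_bot, eq_bot_iff]
    intro x hx
    refine h5 x fun m => ?_
    have hx' : ε x = 0 := hx
    exact LinearMap.congr_fun (show (show C →ₗ[k] k from ε x) = 0 from hx') m
  have hεs : Function.Surjective ε := aux_kdual_surj k ε fun c hc => h6 c hc
  -- finite resolution
  obtain ⟨n0, e0, he0⟩ := Module.Finite.exists_fin' Cᵐᵒᵖ (KDual k C C)
  obtain ⟨n1, f1, hf1⟩ := Module.Finite.exists_fin' Cᵐᵒᵖ (LinearMap.ker e0)
  let e1 : (Fin n1 → Cᵐᵒᵖ) →ₗ[Cᵐᵒᵖ] (Fin n0 → Cᵐᵒᵖ) := (LinearMap.ker e0).subtype.comp f1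
  have he10 : LinearMap.range e1 = LinearMap.ker e0 := by
    rw [LinearMap.range_comp, LinearMap.range_eq_top.2 hf1, Submodule.map_top,
      Submodule.range_subtype]
  let e2 : LinearMap.ker e1 →ₗ[Cᵐᵒᵖ] (Fin n1 → Cᵐᵒᵖ) := (LinearMap.ker e1).subtype
  have he2 : Function.Injective e2 := Submodule.subtype_injective _
  have he21 : LinearMap.range e2 = LinearMap.ker e1 := Submodule.range_subtype _
  obtain ⟨u2, v2, u1, v1, s, t, hu, hv, hs, ht⟩ := aux_comparison d2 d1 (ε.comp d0) e2 e1 e0 hd2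
    (hεs.comp hd0) hd21 (by rw [LinearMap.ker_comp, LinearMap.ker_eq_bot.2 hεi]; exact hd10)
    he2 he0 he21 he10
  let q' : (LinearMap.ker e1 →ₗ[Cᵐᵒᵖ] C) →ₗ[C] E :=
    { toFun := fun g => q (g.comp u2)
      map_add' := fun x y => by rw [LinearMap.add_comp, map_add]
      map_smul' := fun x y => by rw [LinearMap.smul_comp, map_smul, RingHom.id_apply] }
  have hq' : ∀ g, q' g = q (g.comp u2) := fun _ => rfl
  refine ⟨ModuleCat.of _ (LinearMap.ker e1), ModuleCat.of _ (Fin n1 → Cᵐᵒᵖ),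
    ModuleCat.of _ (Fin n0 → Cᵐᵒᵖ), e2, e1, e0, q', ⟨?_, ?_, ?_⟩, ⟨?_, ?_, ?_⟩, he2, he0, he21, he10,
    ?_, ?_⟩
  · change Module.Finite Cᵐᵒᵖ (LinearMap.ker e1); infer_instance
  · change Module.Finite Cᵐᵒᵖ (Fin n1 → Cᵐᵒᵖ); infer_instance
  · change Module.Finite Cᵐᵒᵖ (Fin n0 → Cᵐᵒᵖ); infer_instance
  · refine Module.Projective.of_split (M := P2 × (Fin n1 → Cᵐᵒᵖ)) (P := LinearMap.ker e1)
      (v2.prod e2) (u2.coprod t) ?_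
    refine LinearMap.ext fun x => ?_
    exact (ht x).symm
  · change Module.Projective Cᵐᵒᵖ (Fin n1 → Cᵐᵒᵖ); infer_instance
  · change Module.Projective Cᵐᵒᵖ (Fin n0 → Cᵐᵒᵖ); infer_instance
  · intro x
    obtain ⟨g, rfl⟩ := hq x
    refine ⟨g.comp v2, ?_⟩
    rw [hq', ← sub_eq_zero, ← map_sub, hqd]
    refine ⟨-(g.comp s), LinearMap.ext fun x => ?_⟩
    change g (v2 (u2 x)) - g x = -(g (s (d2 x)))
    conv_lhs => enter [2]; rw [hs x, map_add]
    abel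
  · intro g
    rw [hq', hqd]
    constructor
    · rintro ⟨f, hf⟩
      refine ⟨f.comp v1 + g.comp t, LinearMap.ext fun x => ?_⟩
      change g x = f (v1 (e2 x)) + g (t (e2 x))
      have h7 : g (u2 (v2 x)) = f (d2 (v2 x)) := LinearMap.congr_fun hf (v2 x)
      rw [← hv, ← h7, ← map_add, ← ht]
    · rintro ⟨f, rfl⟩
      refine ⟨f.comp u1, LinearMap.ext fun x => ?_⟩
      change f (e2 (u2 x)) = f (u1 (d2 x))
      rw [hu]

/-- `E` is finite-dimensional -/
theorem aux_relext_finite {C : Type} [Ring C]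
    (E : Type) [AddCommGroup E] [Module C E] (Q2 : Mdl Cᵐᵒᵖ) [Module.Finite Cᵐᵒᵖ Q2]
    [Module.Projective Cᵐᵒᵖ Q2] (q : (Q2 →ₗ[Cᵐᵒᵖ] C) →ₗ[C] E) (hq : Function.Surjective q) :
    Module.Finite C E := by
  obtain ⟨n, x, g, hx⟩ := aux_dual_basis (A := C) Q2
  refine Module.Finite.of_surjective (M := Fin n → C)
    (q.comp (Fintype.linearCombination C g)) (hq.comp fun f => ⟨fun i => f (x i), ?_⟩)
  rw [Fintype.linearCombination_apply]
  exact (aux_dual_expand hx f).symm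

section TrivExtSection

variable (k : Type) [Field k] (C : Type) [Ring C] [Algebra k C] [FiniteDimensional k C]
  (E : Type) [AddCommGroup E] [Module C E] [Module Cᵐᵒᵖ E] [SMulCommClass C Cᵐᵒᵖ E]
  [Module k E] [IsScalarTower k C E] [IsScalarTower k Cᵐᵒᵖ E]

theorem aux_tsze_finite [Module.Finite C E] : FiniteDimensional k (TrivSqZeroExt C E) :=
  haveI : Module.Finite k E := Module.Finite.trans C E
  inferInstanceAs (Module.Finite k (C × E))

variable {C E}

theorem aux_modB_smul (M : Mdl Cᵐᵒᵖ) (b : (TrivSqZeroExt C E)ᵐᵒᵖ) (m : modB C E M) :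
    b • m = (show modB C E M from op (unop b).fst • (show M from m)) := rfl

theorem aux_modB_finite (M : Mdl Cᵐᵒᵖ) [Module.Finite Cᵐᵒᵖ M] :
    Module.Finite (TrivSqZeroExt C E)ᵐᵒᵖ (modB C E M) := by
  obtain ⟨S, hS⟩ := Module.Finite.fg_top (R := Cᵐᵒᵖ) (M := M)
  refine ⟨⟨S, ?_⟩⟩
  rw [eq_top_iff]
  rintro m -
  suffices H : ∀ y : M, y ∈ Submodule.span Cᵐᵒᵖ (S : Set M) →
      (show modB C E M from y) ∈ Submodule.span (TrivSqZeroExt C E)ᵐᵒᵖ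
        (show Set (modB C E M) from (S : Set M)) from H m (by rw [hS]; trivial)
  intro y hy
  induction hy using Submodule.span_induction with
  | mem x hx => exact Submodule.subset_span hx
  | zero => exact Submodule.zero_mem _
  | add x y _ _ hx hy => exact Submodule.add_mem _ hx hy
  | smul a x _ hx =>
    exact Submodule.smul_mem _ (op (TrivSqZeroExt.inl (unop a)) : (TrivSqZeroExt C E)ᵐᵒᵖ) hx

/-- the functional `x ↦ β(m, e x)` -/
def auxDelta {M : Type} [AddCommGroup M] [Module Cᵐᵒᵖ M] (β : M → E → k)
    (hβ : AuxBal k (A := C) M E β) (m : M) (e : E) : KDual k C C :=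
  show C →ₗ[k] k from
    { toFun := fun x => β m (op x • e)
      map_add' := fun x y => by rw [MulOpposite.op_add, add_smul, hβ.2.1]
      map_smul' := fun a x => by
        rw [MulOpposite.op_smul, smul_assoc, ← algebraMap_smul C a, hβ.2.2.1]
        rfl }

theorem auxDelta_ev {M : Type} [AddCommGroup M] [Module Cᵐᵒᵖ M] (β : M → E → k)
    (hβ : AuxBal k (A := C) M E β) (m : M) (e : E) (x : C) :
    (auxDelta k β hβ m e).ev k C C x = β m (op x • e) := rfl

/-- the action of the trivial extension on `DC × M` determined by `β` -/
@[reducible]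
def auxZModule {M : Type} [AddCommGroup M] [Module Cᵐᵒᵖ M] (β : M → E → k)
    (hβ : AuxBal k (A := C) M E β) : Module (TrivSqZeroExt C E)ᵐᵒᵖ (KDual k C C × M) where
  smul b z := (op (unop b).fst • z.1 + auxDelta k β hβ z.2 (unop b).snd, op (unop b).fst • z.2)
  one_smul := by
    rintro ⟨ξ, m⟩
    refine Prod.ext ?_ (one_smul _ m)
    refine KDual.ext' fun x => ?_
    change ξ.ev k C C ((1 : C) • x) + β m (op x • (0 : E)) = _
    have h0 : β m 0 = 0 := by
      have := hβ.2.1 m 0 0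
      rw [add_zero] at this
      exact left_eq_add.1 this
    rw [one_smul, smul_zero, h0, add_zero]
  mul_smul := by
    rintro ⟨c, e⟩ ⟨c', e'⟩ ⟨ξ, m⟩
    refine Prod.ext ?_ (mul_smul (op c) (op c') m)
    refine KDual.ext' fun x => ?_
    change ξ.ev k C C ((c' * c) • x) + β m (op x • (c' • e + op c • e')) =
      ξ.ev k C C (c' • c • x) + β m (op (c • x) • e') + β (op c' • m) (op x • e)
    rw [hβ.2.2.2, smul_add, hβ.2.1, smul_comm c' (op x) e, mul_smul, smul_eq_mul c x, op_mul,
      mul_smul (op x) (op c) e']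
    abel
  smul_zero := by
    rintro ⟨c, e⟩
    refine Prod.ext ?_ (smul_zero (op c))
    refine KDual.ext' fun x => ?_
    change (0 : k) + β 0 (op x • e) = 0
    have h0 : β 0 (op x • e) = 0 := by
      have := hβ.1 0 0 (op x • e)
      rw [add_zero] at this
      exact left_eq_add.1 this
    rw [h0, add_zero]
  smul_add := by
    rintro ⟨c, e⟩ ⟨ξ, m⟩ ⟨ξ', m'⟩
    refine Prod.ext ?_ (smul_add (op c) m m')
    refine KDual.ext' fun x => ?_
    change (ξ.ev k C C (c • x) + ξ'.ev k C C (c • x)) + β (m + m') (op x • e) =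
      (ξ.ev k C C (c • x) + β m (op x • e)) + (ξ'.ev k C C (c • x) + β m' (op x • e))
    rw [hβ.1]
    abel
  add_smul := by
    rintro ⟨c, e⟩ ⟨c', e'⟩ ⟨ξ, m⟩
    refine Prod.ext ?_ (add_smul (op c) (op c') m)
    refine KDual.ext' fun x => ?_
    change ξ.ev k C C ((c + c') • x) + β m (op x • (e + e')) =
      (ξ.ev k C C (c • x) + β m (op x • e)) + (ξ.ev k C C (c' • x) + β m (op x • e'))
    rw [smul_add, hβ.2.1, add_smul, map_add]
    abel
  zero_smul := by
    rintro ⟨ξ, m⟩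
    refine Prod.ext ?_ (zero_smul _ m)
    refine KDual.ext' fun x => ?_
    change ξ.ev k C C ((0 : C) • x) + β m (op x • (0 : E)) = 0
    have h0 : β m 0 = 0 := by
      have := hβ.2.1 m 0 0
      rw [add_zero] at this
      exact left_eq_add.1 this
    rw [zero_smul, map_zero, smul_zero, h0, add_zero]

theorem aux_forward [Module.Finite C E] (M : Mdl Cᵐᵒᵖ) [Module.Finite Cᵐᵒᵖ M]
    (hfaith : ∀ c : C, (∀ m : M, op c • m = 0) → c = 0)
    (h : TauRigid k (TrivSqZeroExt C E) (modB C E M)) : AuxBalZero k C M E := by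
  intro β hβ m e
  haveI := aux_tsze_finite k C E
  haveI : IsArtinianRing (TrivSqZeroExt C E)ᵐᵒᵖ := aux_artinian_op k
  haveI := aux_modB_finite (C := C) (E := E) M
  obtain ⟨P1, P0, d1, d0, hmin, f1, f0⟩ := aux_exists_minpres (modB C E M)
  have hF := aux_factor_of_tauRigid k (TrivSqZeroExt C E) (modB C E M) h d1 d0 hmin
  haveI := hmin.2.1
  haveI := hmin.1.1
  obtain ⟨n, j, hj⟩ := aux_gen k M hfaith
  letI := auxZModule k β hβ
  let X := modB C E (ModuleCat.of Cᵐᵒᵖ (KDual k C C))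
  let π : (Fin n → modB C E M) →ₗ[(TrivSqZeroExt C E)ᵐᵒᵖ] X :=
    { toFun := fun x => j x
      map_add' := fun x y => map_add j x y
      map_smul' := fun b x => j.map_smul (op (unop b).fst) (show Fin n → M from x) }
  have hβ0 : ∀ t, β 0 t = 0 := fun t => by
    have := hβ.1 0 0 t
    rw [add_zero] at this
    exact left_eq_add.1 this
  let i : X →ₗ[(TrivSqZeroExt C E)ᵐᵒᵖ] (KDual k C C × M) :=
    { toFun := fun x => ((show KDual k C C from x), (0 : M))
      map_add' := fun x y => Prod.ext rfl (add_zero (0 : M)).symm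
      map_smul' := fun b x => by
        refine Prod.ext ?_ (smul_zero _).symm
        refine KDual.ext' fun c => ?_
        change KDual.ev k C C (show KDual k C C from x) ((unop b).fst • c) =
          KDual.ev k C C (show KDual k C C from x) ((unop b).fst • c) + β 0 (op c • (unop b).snd)
        rw [hβ0, add_zero] }
  let p : (KDual k C C × M) →ₗ[(TrivSqZeroExt C E)ᵐᵒᵖ] modB C E M :=
    { toFun := fun z => z.2
      map_add' := fun _ _ => rfl
      map_smul' := fun _ _ => rfl }
  obtain ⟨s, hs⟩ := aux_ext_of_factor d1 d0 hmin.2.2.1 hmin.1.2.1 hF n π hj i p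
    (fun x y hxy => congrArg Prod.fst hxy) (fun m => ⟨(0, m), rfl⟩) (by
      ext ⟨ξ, m⟩
      constructor
      · rintro ⟨x, hx⟩
        exact (congrArg Prod.snd hx).symm
      · intro hm
        exact ⟨ξ, Prod.ext rfl (show (0 : M) = m from Eq.symm hm)⟩)
  have h1 := s.map_smul (op (TrivSqZeroExt.inr e)) (show modB C E M from m)
  have h2 : (op (TrivSqZeroExt.inr e) : (TrivSqZeroExt C E)ᵐᵒᵖ) • (show modB C E M from m) = 0 :=
    zero_smul Cᵐᵒᵖ (show M from m)
  rw [h2, map_zero] at h1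
  have h3 := congrArg (fun z => KDual.ev k C C (Prod.fst z) (1 : C)) h1
  have h4 : (s (show modB C E M from m)).2 = m := hs m
  change (0 : k) = KDual.ev k C C (s (show modB C E M from m)).1 ((0 : C) • (1 : C)) +
    β (s (show modB C E M from m)).2 (op (1 : C) • e) at h3
  rw [h4, zero_smul, map_zero, zero_add, op_one, one_smul] at h3
  exact h3.symm

end TrivExtSection

section Backward

variable (k : Type) [Field k] {C : Type} [Ring C] [Algebra k C] [FiniteDimensional k C]
  {E : Type} [AddCommGroup E] [Module C E] [Module Cᵐᵒᵖ E] [SMulCommClass C Cᵐᵒᵖ E]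
  [Module k E] [IsScalarTower k C E] [IsScalarTower k Cᵐᵒᵖ E]

theorem aux_backward_ext (M : Mdl Cᵐᵒᵖ) [Module.Finite Cᵐᵒᵖ M]
    (hrigid : TauRigid k C M) (hB : AuxBalZero k C M E) {X Z : Type}
    [AddCommGroup X] [Module (TrivSqZeroExt C E)ᵐᵒᵖ X]
    [AddCommGroup Z] [Module (TrivSqZeroExt C E)ᵐᵒᵖ Z]
    (π : modB C E M →ₗ[(TrivSqZeroExt C E)ᵐᵒᵖ] X) (hπ : Function.Surjective π)
    (i : X →ₗ[(TrivSqZeroExt C E)ᵐᵒᵖ] Z) (p : Z →ₗ[(TrivSqZeroExt C E)ᵐᵒᵖ] modB C E M)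
    (hi : Function.Injective i) (hp : Function.Surjective p)
    (hip : LinearMap.range i = LinearMap.ker p) :
    ∃ s : modB C E M →ₗ[(TrivSqZeroExt C E)ᵐᵒᵖ] Z, ∀ m, p (s m) = m := by
  haveI : IsArtinianRing Cᵐᵒᵖ := aux_artinian_op k
  have hX : ∀ (e : E) (x : X), (op (TrivSqZeroExt.inr e) : (TrivSqZeroExt C E)ᵐᵒᵖ) • x = 0 := by
    intro e x
    obtain ⟨m, rfl⟩ := hπ x
    rw [← map_smul]
    have h2 : (op (TrivSqZeroExt.inr e) : (TrivSqZeroExt C E)ᵐᵒᵖ) • m = 0 :=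
      zero_smul Cᵐᵒᵖ (show M from m)
    rw [h2, map_zero]
  have hK : ∀ (e : E) (z : Z), p z = 0 →
      (op (TrivSqZeroExt.inr e) : (TrivSqZeroExt C E)ᵐᵒᵖ) • z = 0 := by
    intro e z hz
    have hz' : z ∈ LinearMap.range i := by rw [hip]; exact hz
    obtain ⟨x, rfl⟩ := hz'
    rw [← map_smul, hX, map_zero]
  have hdep : ∀ (e : E) (z z' : Z), p z = p z' →
      (op (TrivSqZeroExt.inr e) : (TrivSqZeroExt C E)ᵐᵒᵖ) • z =
        (op (TrivSqZeroExt.inr e) : (TrivSqZeroExt C E)ᵐᵒᵖ) • z' := by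
    intro e z z' h
    rw [← sub_eq_zero, ← smul_sub]
    exact hK e _ (by rw [map_sub, h, sub_self])
  -- `E` kills `Z`
  have hZ : ∀ (e : E) (z : Z), (op (TrivSqZeroExt.inr e) : (TrivSqZeroExt C E)ᵐᵒᵖ) • z = 0 := by
    letI : Module k Z := Module.compHom Z (algebraMap k (TrivSqZeroExt C E)ᵐᵒᵖ)
    intro e z
    rw [← Module.forall_dual_apply_eq_zero_iff k]
    intro l
    obtain ⟨g, hg⟩ := hp.hasRightInverse
    let G : M → Z := g
    have hval : ∀ (e : E) (m : M) (z : Z), (show M from p z) = m →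
        l ((op (TrivSqZeroExt.inr e) : (TrivSqZeroExt C E)ᵐᵒᵖ) • G m)
        = l ((op (TrivSqZeroExt.inr e) : (TrivSqZeroExt C E)ᵐᵒᵖ) • z) := by
      intro e m z h
      rw [hdep e (G m) z ((hg _).trans h.symm)]
    have hG : ∀ m : M, (show M from p (G m)) = m := hg
    have key := hB (fun m e => l ((op (TrivSqZeroExt.inr e) : (TrivSqZeroExt C E)ᵐᵒᵖ) • G m))
      ⟨?_, ?_, ?_, ?_⟩ (show M from p z) e
    · exact (hval e _ z rfl).symm.trans key
    · intro m m' t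
      rw [← map_add, ← smul_add]
      refine hval t _ _ ?_
      exact (p.map_add _ _).trans (congrArg₂ (fun x y : M => x + y) (hG m) (hG m'))
    · intro m t t'
      rw [← map_add, ← add_smul, ← MulOpposite.op_add, ← TrivSqZeroExt.inr_add]
    · intro c m t
      have h1 : (op (TrivSqZeroExt.inr (algebraMap k C c • t)) : (TrivSqZeroExt C E)ᵐᵒᵖ) =
          algebraMap k (TrivSqZeroExt C E)ᵐᵒᵖ c * op (TrivSqZeroExt.inr t) := by
        rw [Algebra.commutes]
        change _ = op (algebraMap k (TrivSqZeroExt C E) c * TrivSqZeroExt.inr t)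
        rw [← TrivSqZeroExt.inl_mul_inr]
        rfl
      change l ((op (TrivSqZeroExt.inr (algebraMap k C c • t)) : (TrivSqZeroExt C E)ᵐᵒᵖ) • G m) = _
      rw [h1, mul_smul]
      exact l.map_smul c _
    · intro a m t
      have h1 : (show M from p ((op (TrivSqZeroExt.inl a) : (TrivSqZeroExt C E)ᵐᵒᵖ) • G m)) =
          op a • m :=
        (p.map_smul _ _).trans (congrArg (fun x : M => op a • x) (hG m))
      refine (hval t _ _ h1).trans ?_
      rw [← mul_smul, ← op_mul, TrivSqZeroExt.inl_mul_inr]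
  -- view everything over `C`
  letI : Module Cᵐᵒᵖ Z := Module.compHom Z (RingHom.op (tszeInl C E))
  letI : Module Cᵐᵒᵖ X := Module.compHom X (RingHom.op (tszeInl C E))
  obtain ⟨P1, P0, d1, d0, hmin, f1, f0⟩ := aux_exists_minpres M
  have hF := aux_factor_of_tauRigid k C M hrigid d1 d0 hmin
  haveI := hmin.2.1
  haveI := hmin.1.1
  let π' : (Fin 1 → M) →ₗ[Cᵐᵒᵖ] X :=
    { toFun := fun x => π (show modB C E M from x 0)
      map_add' := fun x y => π.map_add (show modB C E M from x 0) (show modB C E M from y 0)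
      map_smul' := fun c x => π.map_smul (op (TrivSqZeroExt.inl (unop c)))
        (show modB C E M from x 0) }
  let i' : X →ₗ[Cᵐᵒᵖ] Z :=
    { toFun := fun x => i x
      map_add' := fun x y => i.map_add x y
      map_smul' := fun c x => i.map_smul (op (TrivSqZeroExt.inl (unop c))) x }
  let p' : Z →ₗ[Cᵐᵒᵖ] M :=
    { toFun := fun x => p x
      map_add' := fun x y => p.map_add x y
      map_smul' := fun c x => p.map_smul (op (TrivSqZeroExt.inl (unop c))) x }
  obtain ⟨s, hs⟩ := aux_ext_of_factor d1 d0 hmin.2.2.1 hmin.1.2.1 hF 1 π'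
    (fun x => by obtain ⟨m, hm⟩ := hπ x; exact ⟨fun _ => m, hm⟩) i' p' hi hp (by
      ext z
      exact SetLike.ext_iff.1 hip z)
  refine ⟨{ toFun := fun m => s m
            map_add' := fun x y => s.map_add x y
            map_smul' := fun b x => ?_ }, hs⟩
  have h1 := s.map_smul (op (unop b).fst) (show M from x)
  refine Eq.trans h1 ?_
  change (op (TrivSqZeroExt.inl (unop b).fst) : (TrivSqZeroExt C E)ᵐᵒᵖ) • s (show M from x) =
    b • s (show M from x)
  have h2 : b = op (TrivSqZeroExt.inl (unop b).fst) + op (TrivSqZeroExt.inr (unop b).snd) := by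
    rw [← MulOpposite.op_add, TrivSqZeroExt.inl_fst_add_inr_snd_eq, op_unop]
  conv_rhs => rw [h2, add_smul, hZ, add_zero]

theorem aux_backward [Module.Finite C E] (M : Mdl Cᵐᵒᵖ) [Module.Finite Cᵐᵒᵖ M]
    (hrigid : TauRigid k C M) (hB : AuxBalZero k C M E) :
    TauRigid k (TrivSqZeroExt C E) (modB C E M) := by
  haveI := aux_tsze_finite k C E
  haveI : IsArtinianRing (TrivSqZeroExt C E)ᵐᵒᵖ := aux_artinian_op k
  haveI := aux_modB_finite (C := C) (E := E) M
  refine aux_tauRigid_of_factor k (TrivSqZeroExt C E) (modB C E M) fun P1 P0 d1 d0 hmin => ?_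
  obtain ⟨f1, f0⟩ := aux_minpres_finite hmin
  haveI := hmin.2.1
  haveI := hmin.1.1
  refine aux_factor_of_ext d1 d0 hmin.2.2.1 hmin.1.2.1 hmin.2.2.2 ?_
  intro L Z _ _ i p hi hp hip
  exact aux_backward_ext k M hrigid hB L.mkQ (Submodule.mkQ_surjective _) i p hi hp hip

end Backward

/-- A faithful `τ_C`-rigid module `M` is `τ_B`-rigid iff `id_C M ≤ 1`. -/
theorem faithful_tau_rigid_iff
    (k : Type) [Field k] (C : Type) [Ring C] [Algebra k C] [FiniteDimensional k C]
    (E : Type) [AddCommGroup E] [Module C E] [Module Cᵐᵒᵖ E] [SMulCommClass C Cᵐᵒᵖ E]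
    [Module k E] [IsScalarTower k C E] [IsScalarTower k Cᵐᵒᵖ E]
    (hgl : GlDimEq2 Cᵐᵒᵖ) (hE : IsRelExt k C E)
    (M : Mdl Cᵐᵒᵖ) [Module.Finite Cᵐᵒᵖ M]
    (hfaith : ∀ c : C, (∀ m : M, op c • m = 0) → c = 0)
    (hrigid : TauRigid k C M) :
    TauRigid k (TrivSqZeroExt C E) (modB C E M) ↔ IdLE1 Cᵐᵒᵖ M := by
  obtain ⟨Q2, Q1, Q0, e2, e1, e0, q, ⟨f2, f1, f0⟩, ⟨p2, p1, p0⟩, he2, he0, he21, he10, hq, hqd⟩ :=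
    aux_relext k C E hE
  haveI := aux_relext_finite E Q2 q hq
  constructor
  · intro h
    have hB := aux_forward k M hfaith h
    exact aux_idLE1_of_factor hgl.1 e2 e1 e0 he2 he0 he21 he10
      (fun N _ _ _ => aux_cog k N) M (aux_factor_of_bal k e2 q hq hqd hB)
  · intro h
    have hF := aux_factor_of_idLE1 M h e2 e1 he2 he21
    exact aux_backward k M hrigid (aux_bal_of_factor k e2 q hq hqd hF)
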